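/- For each n ≥ 1 let i_n denote the number of pairs (F, J) where F is an acyclic simple graph (forest) on the vertex set Fin n and J is a maximal independent set of F, and let f_n denote the number of acyclic simple graphs on Fin n. Then there exist real constants C > 0 and α > 1 such that the sequence (i_n / f_n) / α^n converges to C as n → ∞. In other words, the average number of maximal independent sets of a uniformly random forest on n vertices grows like C·α^n with α > 1. -/

import Mathlib

open Filter Topology MeasureTheory

/-- `J` is an independent set of the simple graph `G`. -/
def IsIndepSet {V : Type*} (G : SimpleGraph V) (J : Set V) : Prop :=
  ∀ ⦃u v : V⦄, u ∈ J → v ∈ J → ¬ G.Adj u v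

/-- `J` is a maximal independent set of `G`. -/
def IsMaximalIndepSet {V : Type*} (G : SimpleGraph V) (J : Set V) : Prop :=
  IsIndepSet G J ∧ ∀ J' : Set V, IsIndepSet G J' → ¬ J ⊂ J'

/-- The pairs `(F, J)` where `F` is a forest (acyclic simple graph) on `Fin n`
and `J` is a maximal independent set of `F`. -/
def MISpace (n : ℕ) :=
  {p : SimpleGraph (Fin n) × Set (Fin n) // p.1.IsAcyclic ∧ IsMaximalIndepSet p.1 p.2}

/-- `iN n` is the number of pairs `(F, J)` where `F` is a forest on `Fin n`
and `J` is a maximal independent set of `F`. -/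
noncomputable def iN (n : ℕ) : ℕ := Nat.card (MISpace n)

/-- `fN n` is the number of forests (acyclic simple graphs) on `Fin n`. -/
noncomputable def fN (n : ℕ) : ℕ := Nat.card {G : SimpleGraph (Fin n) // G.IsAcyclic}

namespace SimpleGraph

variable {V : Type*} {G : SimpleGraph V} {U : Set V}

/-- The edges of `G` between `U` and its complement are the pairs prescribed by `R`. -/
def CrossBy (G : SimpleGraph V) (U : Set V) (R : V → V → Prop) : Prop :=
  ∀ ⦃x⦄, x ∈ U → ∀ ⦃y⦄, y ∉ U → (G.Adj x y ↔ R x y)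

/-- `c r` is the only edge of `G` between `U` and its complement. -/
def IsCut (G : SimpleGraph V) (U : Set V) (c r : V) : Prop :=
  c ∈ U ∧ r ∉ U ∧ G.CrossBy U fun x y => x = c ∧ y = r

lemma IsCut.adj {c r : V} (h : G.IsCut U c r) : G.Adj c r :=
  (h.2.2 h.1 h.2.1).2 ⟨rfl, rfl⟩

lemma IsCut.compl {c r : V} (h : G.IsCut U c r) : G.IsCut Uᶜ r c := by
  obtain ⟨h1, h2, h3⟩ := h
  refine ⟨h2, by simpa using h1, fun x hx y hy => ?_⟩
  rw [G.adj_comm, h3 (by simpa using hy) hx]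
  tauto

lemma CrossBy.compl (h : G.CrossBy U fun _ _ => False) : G.CrossBy Uᶜ fun _ _ => False := by
  intro x hx y hy
  rw [G.adj_comm]
  exact h (by simpa using hy) hx

lemma reachable_induce_of_crossBy (h : G.CrossBy U fun _ _ => False) {x y : V} (hx : x ∈ U)
    (hxy : G.Reachable x y) : ∃ hy : y ∈ U, (G.induce U).Reachable ⟨x, hx⟩ ⟨y, hy⟩ := by
  obtain ⟨p⟩ := hxy
  induction p with
  | nil => exact ⟨hx, .rfl⟩
  | @cons u v w huv p ih =>
    have hv : v ∈ U := by
      by_contra hv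
      exact (h hx hv).1 huv
    obtain ⟨hw, hr⟩ := ih hv
    refine ⟨hw, Reachable.trans (Adj.reachable ?_) hr⟩
    simpa using huv

lemma not_reachable_of_crossBy (h : G.CrossBy U fun _ _ => False) {x y : V} (hx : x ∈ U)
    (hy : y ∉ U) : ¬ G.Reachable x y := fun hr =>
  hy (reachable_induce_of_crossBy h hx hr).1

lemma isBridge_of_crossBy (h : G.CrossBy U fun _ _ => False) (hU : (G.induce U).IsAcyclic)
    {v w : V} (hv : v ∈ U) (hvw : G.Adj v w) : G.IsBridge s(v, w) := by
  have hw : w ∈ U := by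
    by_contra hw
    exact (h hv hw).1 hvw
  have hb := isAcyclic_iff_forall_adj_isBridge.1 hU (v := ⟨v, hv⟩) (w := ⟨w, hw⟩)
      (by simpa using hvw)
  intro hr
  apply hb
  obtain ⟨_, hr'⟩ := reachable_induce_of_crossBy (U := U)
    (fun x hx y hy => iff_false_intro fun hadj => (h hx hy).1 (deleteEdges_le _ hadj)) hv hr
  refine hr'.mono ?_
  intro a b hab
  simp only [comap_adj, Function.Embedding.subtype_apply, deleteEdges_adj, Set.mem_singleton_iff,
    Sym2.eq, Sym2.rel_iff', Prod.mk.injEq, Prod.swap_prod_mk] at hab ⊢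
  simpa [Subtype.ext_iff] using hab

lemma CrossBy.isAcyclic_iff (h : G.CrossBy U fun _ _ => False) :
    G.IsAcyclic ↔ (G.induce Uᶜ).IsAcyclic ∧ (G.induce U).IsAcyclic := by
  refine ⟨fun hG => ⟨hG.induce _, hG.induce _⟩, fun ⟨h1, h2⟩ => ?_⟩
  refine isAcyclic_iff_forall_adj_isBridge.2 fun v w hvw => ?_
  by_cases hv : v ∈ U
  · exact isBridge_of_crossBy h h2 hv hvw
  · exact isBridge_of_crossBy h.compl h1 hv hvw

lemma IsCut.crossBy_deleteEdges {c r : V} (h : G.IsCut U c r) :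
    (G.deleteEdges {s(c, r)}).CrossBy U fun _ _ => False := by
  intro x hx y hy
  simp [deleteEdges_adj, h.2.2 hx hy]
  tauto

lemma IsCut.isAcyclic {c r : V} (h : G.IsCut U c r) (h1 : (G.induce Uᶜ).IsAcyclic)
    (h2 : (G.induce U).IsAcyclic) : G.IsAcyclic := by
  have hH : (G.deleteEdges {s(c, r)}).IsAcyclic :=
    h.crossBy_deleteEdges.isAcyclic_iff.2
      ⟨h1.anti (comap_monotone _ (deleteEdges_le _)), h2.anti (comap_monotone _ (deleteEdges_le _))⟩
  have hnr := not_reachable_of_crossBy h.crossBy_deleteEdges h.1 h.2.1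
  refine (hH.sup_edge_of_not_reachable hnr).anti ?_
  intro a b hab
  by_cases hs : s(a, b) = s(c, r)
  · right
    have := hab.ne
    simp only [edge_adj]
    simp at hs
    tauto
  · left
    simp only [deleteEdges_adj, Set.mem_singleton_iff]
    exact ⟨hab, hs⟩

lemma IsCut.reachable_induce {c r x y : V} (h : G.IsCut U c r) (hx : x ∈ U)
    (hxy : G.Reachable y x) :
    (∀ hy : y ∈ U, (G.induce U).Reachable ⟨y, hy⟩ ⟨x, hx⟩) ∧
      (y ∉ U → (G.induce U).Reachable ⟨c, h.1⟩ ⟨x, hx⟩) := by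
  obtain ⟨p⟩ := hxy
  induction p with
  | nil => exact ⟨fun _ => .rfl, fun hy => absurd hx hy⟩
  | @cons u v w huv p ih =>
    obtain ⟨ih1, ih2⟩ := ih hx
    by_cases hv : v ∈ U
    · refine ⟨fun hu => Reachable.trans (Adj.reachable ?_) (ih1 hv), fun hu => ?_⟩
      · simpa using huv
      · obtain ⟨rfl, -⟩ := (h.2.2 hv hu).1 huv.symm
        exact ih1 hv
    · refine ⟨fun hu => ?_, fun _ => ih2 hv⟩
      obtain ⟨rfl, -⟩ := (h.2.2 hu hv).1 huv
      exact ih2 hv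

lemma IsCut.connected_induce {c r : V} (h : G.IsCut U c r) (hG : G.Connected) :
    (G.induce U).Connected := by
  have : Nonempty U := ⟨⟨c, h.1⟩⟩
  exact ⟨fun x y => (h.reachable_induce y.2 (hG.preconnected x y)).1 x.2⟩

lemma IsCut.connected {c r : V} (h : G.IsCut U c r) (h1 : (G.induce Uᶜ).Connected)
    (h2 : (G.induce U).Connected) : G.Connected := by
  have : Nonempty V := ⟨c⟩
  have key : ∀ x, G.Reachable x c := by
    intro x
    by_cases hx : x ∈ U
    · exact (h2.preconnected ⟨x, hx⟩ ⟨c, h.1⟩).map (Embedding.induce U).toHom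
    · exact ((h1.preconnected ⟨x, hx⟩ ⟨r, h.2.1⟩).map (Embedding.induce Uᶜ).toHom).trans
        h.adj.symm.reachable
  exact ⟨fun x y => (key x).trans (key y).symm⟩

lemma IsCut.isTree_iff {c r : V} (h : G.IsCut U c r) :
    G.IsTree ↔ (G.induce Uᶜ).IsTree ∧ (G.induce U).IsTree :=
  ⟨fun hG => ⟨⟨h.compl.connected_induce hG.1, hG.2.induce _⟩,
    ⟨h.connected_induce hG.1, hG.2.induce _⟩⟩,
    fun ⟨h1, h2⟩ => ⟨h.connected h1.1 h2.1, h.isAcyclic h1.2 h2.2⟩⟩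

lemma IsTree.exists_isCut (hG : G.IsTree) {r v : V} (hrv : r ≠ v) :
    ∃ U c, v ∈ U ∧ G.IsCut U c r := by
  classical
  obtain ⟨p, hp⟩ := (hG.1.preconnected r v).exists_isPath
  cases p with
  | nil => exact absurd rfl hrv
  | @cons _ c _ hrc q =>
    rw [Walk.cons_isPath_iff] at hp
    have hb := isAcyclic_iff_forall_adj_isBridge.1 hG.2 hrc.symm
    refine ⟨{x | (G.deleteEdges {s(c, r)}).Reachable c x}, c, ?_, .rfl, hb, ?_⟩
    · refine ⟨q.toDeleteEdges _ fun e he hs => hp.2 ?_⟩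
      rw [Set.mem_singleton_iff] at hs
      subst hs
      exact Walk.snd_mem_support_of_mem_edges _ he
    · intro x hx y hy
      refine ⟨fun hadj => ?_, fun ⟨h1, h2⟩ => h1 ▸ h2 ▸ hrc.symm⟩
      by_contra hne
      have hxy : ¬ s(x, y) = s(c, r) := by
        intro hs
        simp only [Sym2.eq, Sym2.rel_iff', Prod.mk.injEq, Prod.swap_prod_mk] at hs
        rcases hs with hs | hs
        · exact hne hs
        · exact hb (hs.1 ▸ hx)
      refine hy (Reachable.trans hx (Adj.reachable ?_))
      simp only [deleteEdges_adj, Set.mem_singleton_iff]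
      exact ⟨hadj, hxy⟩

lemma IsTree.isCut_subset (hG : G.IsTree) {r v c c' : V} {U' : Set V} (hv : v ∈ U)
    (hv' : v ∈ U') (h : G.IsCut U c r) (h' : G.IsCut U' c' r) : U ⊆ U' := by
  have key : ∀ a b : U, (G.induce U).Reachable a b → (a : V) ∈ U' → (b : V) ∈ U' := by
    rintro a b ⟨p⟩ ha
    induction p with
    | nil => exact ha
    | @cons a b _ hab p ih =>
      refine ih ?_
      by_contra hb
      have hr := ((h'.2.2 ha hb).1 (by simpa using hab)).2
      exact h.2.1 (hr ▸ b.2)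
  intro x hx
  exact key ⟨v, hv⟩ ⟨x, hx⟩ ((h.connected_induce hG.1).preconnected _ _) hv'

lemma IsTree.isCut_unique (hG : G.IsTree) {r v c c' : V} {U' : Set V} (hv : v ∈ U)
    (hv' : v ∈ U') (h : G.IsCut U c r) (h' : G.IsCut U' c' r) : U = U' ∧ c = c' := by
  obtain rfl := (hG.isCut_subset hv hv' h h').antisymm (hG.isCut_subset hv' hv h' h)
  exact ⟨rfl, ((h'.2.2 h.1 h.2.1).1 h.adj).1⟩

lemma crossBy_connectedComponent (G : SimpleGraph V) (v : V) :
    G.CrossBy {x | G.Reachable v x} fun _ _ => False := by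
  intro x hx y hy
  exact iff_false_intro fun hadj => hy (Reachable.trans hx hadj.reachable)

lemma connected_induce_reachable (G : SimpleGraph V) (v : V) :
    (G.induce {x | G.Reachable v x}).Connected := by
  have key : ∀ x : {x | G.Reachable v x},
      (G.induce {x | G.Reachable v x}).Reachable ⟨v, Reachable.rfl⟩ x := fun x =>
    (reachable_induce_of_crossBy (crossBy_connectedComponent G v) (x := v) Reachable.rfl x.2).2
  have : Nonempty {x | G.Reachable v x} := ⟨⟨v, Reachable.rfl⟩⟩
  exact ⟨fun x y => (key x).symm.trans (key y)⟩

lemma CrossBy.eq_reachable {v : V} (hv : v ∈ U) (h : G.CrossBy U fun _ _ => False)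
    (hc : (G.induce U).Connected) : U = {x | G.Reachable v x} := by
  ext x
  refine ⟨fun hx => ?_, fun hx => (reachable_induce_of_crossBy h hv hx).1⟩
  exact (hc.preconnected ⟨v, hv⟩ ⟨x, hx⟩).map (Embedding.induce U).toHom

end SimpleGraph

namespace SimpleGraph

section Counting

variable {V : Type*}

/-- A graph with a vertex set, restricted to `U`. -/
def restrictPair (U : Set V) (p : SimpleGraph V × Set V) : SimpleGraph U × Set U :=
  (p.1.induce U, Subtype.val ⁻¹' p.2)

/-- The pair on `V` glued from pairs on `Uᶜ` and `U`, with edges across given by `R`. -/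
def gluePair (U : Set V) (R : V → V → Prop)
    (q : (SimpleGraph ↥Uᶜ × Set ↥Uᶜ) × (SimpleGraph U × Set U)) : SimpleGraph V × Set V :=
  ({ Adj := fun x y =>
      (∃ (hx : x ∈ Uᶜ) (hy : y ∈ Uᶜ), q.1.1.Adj ⟨x, hx⟩ ⟨y, hy⟩) ∨
      (∃ (hx : x ∈ U) (hy : y ∈ U), q.2.1.Adj ⟨x, hx⟩ ⟨y, hy⟩) ∨
      (x ∈ U ∧ y ∉ U ∧ R x y) ∨ (y ∈ U ∧ x ∉ U ∧ R y x)
     symm := ⟨by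
      rintro x y (⟨hx, hy, h⟩ | ⟨hx, hy, h⟩ | h | h)
      · exact .inl ⟨hy, hx, h.symm⟩
      · exact .inr (.inl ⟨hy, hx, h.symm⟩)
      · exact .inr (.inr (.inr h))
      · exact .inr (.inr (.inl h))⟩
     loopless := ⟨by
      rintro x (⟨hx, hy, h⟩ | ⟨hx, hy, h⟩ | h | h)
      · exact h.ne rfl
      · exact h.ne rfl
      · exact h.2.1 h.1
      · exact h.2.1 h.1⟩ },
   {x | (∃ hx : x ∈ Uᶜ, ⟨x, hx⟩ ∈ q.1.2) ∨ ∃ hx : x ∈ U, ⟨x, hx⟩ ∈ q.2.2})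

lemma crossBy_gluePair (U : Set V) (R : V → V → Prop)
    (q : (SimpleGraph ↥Uᶜ × Set ↥Uᶜ) × (SimpleGraph U × Set U)) :
    (gluePair U R q).1.CrossBy U R := by
  intro x hx y hy
  simp [gluePair, hx, hy]

lemma restrictPair_gluePair (U : Set V) (R : V → V → Prop)
    (q : (SimpleGraph ↥Uᶜ × Set ↥Uᶜ) × (SimpleGraph U × Set U)) :
    (restrictPair Uᶜ (gluePair U R q), restrictPair U (gluePair U R q)) = q := by
  obtain ⟨⟨G1, J1⟩, ⟨G2, J2⟩⟩ := q
  simp only [restrictPair, Prod.mk.injEq]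
  refine ⟨⟨?_, ?_⟩, ⟨?_, ?_⟩⟩
  · ext ⟨x, hx⟩ ⟨y, hy⟩
    have hx' : x ∉ U := hx
    have hy' : y ∉ U := hy
    simp [gluePair, hx', hy']
  · ext ⟨x, hx⟩
    have hx' : x ∉ U := hx
    simp [gluePair, hx']
  · ext ⟨x, hx⟩ ⟨y, hy⟩
    simp [gluePair, hx, hy]
  · ext ⟨x, hx⟩
    simp [gluePair]

lemma gluePair_restrictPair (U : Set V) (R : V → V → Prop) (p : SimpleGraph V × Set V)
    (hp : p.1.CrossBy U R) : gluePair U R (restrictPair Uᶜ p, restrictPair U p) = p := by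
  obtain ⟨G, J⟩ := p
  simp only [gluePair, restrictPair, Prod.mk.injEq]
  constructor
  · ext x y
    by_cases hx : x ∈ U <;> by_cases hy : y ∈ U
    · simp [hx, hy]
    · simp [hx, hy, ← hp hx hy]
    · simp [hx, hy, ← hp hy hx, G.adj_comm]
    · simp [hx, hy]
  · ext x
    by_cases hx : x ∈ U <;> simp [hx]

lemma card_crossBy (U : Set V) (R : V → V → Prop) (Φ : SimpleGraph V × Set V → Prop)
    (Φ₁ : SimpleGraph ↥Uᶜ × Set ↥Uᶜ → Prop) (Φ₂ : SimpleGraph U × Set U → Prop)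
    (h : ∀ p, p.1.CrossBy U R → (Φ p ↔ Φ₁ (restrictPair Uᶜ p) ∧ Φ₂ (restrictPair U p))) :
    Nat.card {p : SimpleGraph V × Set V // p.1.CrossBy U R ∧ Φ p} =
      Nat.card {p // Φ₁ p} * Nat.card {p // Φ₂ p} := by
  rw [← Nat.card_prod]
  refine Nat.card_congr
    { toFun := fun p => (⟨_, ((h p.1 p.2.1).1 p.2.2).1⟩, ⟨_, ((h p.1 p.2.1).1 p.2.2).2⟩)
      invFun := fun q => ⟨gluePair U R (q.1.1, q.2.1), crossBy_gluePair _ _ _, ?_⟩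
      left_inv := fun p => Subtype.ext (gluePair_restrictPair U R p.1 p.2.1)
      right_inv := fun q => ?_ }
  · rw [h _ (crossBy_gluePair _ _ _)]
    have := restrictPair_gluePair U R (q.1.1, q.2.1)
    rw [Prod.mk.injEq] at this
    rw [this.1, this.2]
    exact ⟨q.1.2, q.2.2⟩
  · have := restrictPair_gluePair U R (q.1.1, q.2.1)
    rw [Prod.mk.injEq] at this
    exact Prod.ext (Subtype.ext this.1) (Subtype.ext this.2)

end Counting

lemma card_eq_sum_of_existsUnique {α ι : Type*} [Finite α] (s : Finset ι) (Φ : α → Prop)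
    (Ψ : ι → α → Prop) (h : ∀ i ∈ s, ∀ a, Ψ i a → Φ a)
    (hex : ∀ a, Φ a → ∃ i ∈ s, Ψ i a)
    (huniq : ∀ a, Φ a → ∀ i ∈ s, ∀ j ∈ s, Ψ i a → Ψ j a → i = j) :
    Nat.card {a // Φ a} = ∑ i ∈ s, Nat.card {a // Ψ i a} := by
  classical
  have := Fintype.ofFinite α
  simp only [Nat.card_eq_fintype_card, Fintype.card_subtype]
  rw [← Finset.card_biUnion]
  · congr 1
    ext a
    simp only [Finset.mem_filter, Finset.mem_univ, true_and, Finset.mem_biUnion]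
    exact ⟨hex a, fun ⟨i, hi, ha⟩ => h i hi a ha⟩
  · intro i hi j hj hij
    rw [Function.onFun, Finset.disjoint_left]
    intro a ha hb
    simp only [Finset.mem_filter, Finset.mem_univ, true_and] at ha hb
    exact hij (huniq a (h i hi a ha) i hi j hj ha hb)

/-- A property of a graph with a root and a vertex set. -/
abbrev RootedPred := ∀ V : Type, V → SimpleGraph V → Set V → Prop

/-- Invariance of a rooted property under relabelling of the vertices. -/
def RootedPred.Invariant (P : RootedPred) : Prop :=
  ∀ ⦃V W : Type⦄ (e : V ≃ W) (r : V) (G : SimpleGraph W) (J : Set W),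
    P V r (G.comap e) (e ⁻¹' J) ↔ P W (e r) G J

/-- The number of trees on `V` with a vertex set that satisfy `P` at the root `r`. -/
noncomputable def treeCount (P : RootedPred) (V : Type) (r : V) : ℕ :=
  Nat.card {p : SimpleGraph V × Set V // p.1.IsTree ∧ P V r p.1 p.2}

/-- The number of forests on `V` with a vertex set that satisfy `P`. -/
noncomputable def forestCount (P : ∀ V : Type, SimpleGraph V → Set V → Prop) (V : Type) : ℕ :=
  Nat.card {p : SimpleGraph V × Set V // p.1.IsAcyclic ∧ P V p.1 p.2}

/-- `comap` along an equivalence, for graphs with a vertex set. -/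
def comapPairEquiv {V W : Type*} (e : V ≃ W) :
    SimpleGraph W × Set W ≃ SimpleGraph V × Set V where
  toFun p := (p.1.comap e, e ⁻¹' p.2)
  invFun p := (p.1.comap e.symm, e.symm ⁻¹' p.2)
  left_inv p := by ext <;> simp
  right_inv p := by ext <;> simp

lemma treeCount_congr {P : RootedPred} (hP : P.Invariant) {V W : Type} (e : V ≃ W) (r : V) :
    treeCount P V r = treeCount P W (e r) := by
  refine (Nat.card_congr ((comapPairEquiv e).subtypeEquiv fun p => ?_)).symm
  exact and_congr (Iso.comap e p.1).isTree_iff.symm (hP e r p.1 p.2).symm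

lemma treeCount_eq {P : RootedPred} (hP : P.Invariant) {V : Type} [Fintype V] {n : ℕ}
    (hV : Fintype.card V = n + 1) (r : V) : treeCount P V r = treeCount P (Fin (n + 1)) 0 := by
  classical
  let e := Fintype.equivFinOfCardEq hV
  rw [treeCount_congr hP (e.trans (Equiv.swap (e r) 0)) r]
  simp

lemma sum_filter_mem_notMem {V : Type*} [Fintype V] [DecidableEq V] {n : ℕ}
    (hV : Fintype.card V = n + 2) {r v : V} (hrv : r ≠ v) (f : ℕ → ℕ) :
    ∑ U : Finset V with v ∈ U ∧ r ∉ U, f U.card =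
      ∑ j ∈ Finset.range (n + 1), n.choose j * f (j + 1) := by
  have hc : ((Finset.univ.erase r).erase v : Finset V).card = n := by
    rw [Finset.card_erase_of_mem (by simp [hrv.symm]), Finset.card_erase_of_mem (by simp),
      Finset.card_univ, hV]
    rfl
  have h := Finset.sum_powerset_apply_card (fun m => f (m + 1)) (x := (Finset.univ.erase r).erase v)
  rw [hc] at h
  simp only [smul_eq_mul] at h
  rw [← h]
  symm
  refine Finset.sum_bij' (fun U _ => insert v U) (fun U _ => U.erase v) ?_ ?_ ?_ ?_ ?_
  · intro U hU
    simp only [Finset.mem_powerset, Finset.subset_iff, Finset.mem_erase, Finset.mem_univ] at hU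
    simp only [Finset.mem_filter, Finset.mem_univ, true_and, Finset.mem_insert, true_or, hrv,
      false_or]
    exact fun h => (hU h).2.1 rfl
  · intro U hU
    simp only [Finset.mem_filter, Finset.mem_univ, true_and] at hU
    simp only [Finset.mem_powerset, Finset.subset_iff, Finset.mem_erase, Finset.mem_univ]
    rintro x ⟨hx, hxU⟩
    refine ⟨hx, ?_, trivial⟩
    rintro rfl
    exact hU.2 hxU
  · intro U hU
    apply Finset.erase_insert
    simp only [Finset.mem_powerset, Finset.subset_iff, Finset.mem_erase, Finset.mem_univ] at hU
    exact fun h => (hU h).1 rfl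
  · intro U hU
    simp only [Finset.mem_filter, Finset.mem_univ, true_and] at hU
    exact Finset.insert_erase hU.1
  · intro U hU
    rw [Finset.card_insert_of_notMem]
    simp only [Finset.mem_powerset, Finset.subset_iff, Finset.mem_erase, Finset.mem_univ] at hU
    exact fun h => (hU h).1 rfl

lemma sum_filter_mem {V : Type*} [Fintype V] [DecidableEq V] {n : ℕ}
    (hV : Fintype.card V = n + 1) (v : V) (f : ℕ → ℕ) :
    ∑ U : Finset V with v ∈ U, f U.card =
      ∑ j ∈ Finset.range (n + 1), n.choose j * f (j + 1) := by
  have hc : (Finset.univ.erase v : Finset V).card = n := by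
    rw [Finset.card_erase_of_mem (by simp), Finset.card_univ, hV]
    rfl
  have h := Finset.sum_powerset_apply_card (fun m => f (m + 1)) (x := Finset.univ.erase v)
  rw [hc] at h
  simp only [smul_eq_mul] at h
  rw [← h]
  symm
  refine Finset.sum_bij' (fun U _ => insert v U) (fun U _ => U.erase v) ?_ ?_ ?_ ?_ ?_
  · intro U hU
    simp
  · intro U hU
    simp only [Finset.mem_powerset, Finset.subset_iff, Finset.mem_erase, Finset.mem_univ]
    rintro x ⟨hx, hxU⟩
    exact ⟨hx, trivial⟩
  · intro U hU
    apply Finset.erase_insert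
    simp only [Finset.mem_powerset, Finset.subset_iff, Finset.mem_erase, Finset.mem_univ] at hU
    exact fun h => (hU h).1 rfl
  · intro U hU
    simp only [Finset.mem_filter, Finset.mem_univ, true_and] at hU
    exact Finset.insert_erase hU
  · intro U hU
    rw [Finset.card_insert_of_notMem]
    simp only [Finset.mem_powerset, Finset.subset_iff, Finset.mem_erase, Finset.mem_univ] at hU
    exact fun h => (hU h).1 rfl

/-- `P` holds at the root of a tree exactly if `P₁` holds at the root of what is left when the
branch at a neighbour `c` of the root is removed, and `Q` holds at the root `c` of the branch. -/
def RootedPred.Splits (P P₁ Q : RootedPred) : Prop :=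
  ∀ ⦃V : Type⦄ (G : SimpleGraph V) (U : Set V) (c r : V) (J : Set V) (h : G.IsCut U c r),
    P V r G J ↔ P₁ ↥Uᶜ ⟨r, h.2.1⟩ (G.induce Uᶜ) (Subtype.val ⁻¹' J) ∧
      Q U ⟨c, h.1⟩ (G.induce U) (Subtype.val ⁻¹' J)

theorem treeCount_succ {P P₁ Q : RootedPred} (h₁ : P₁.Invariant) (hQ : Q.Invariant)
    (h : P.Splits P₁ Q) (n : ℕ) :
    treeCount P (Fin (n + 2)) 0 = ∑ j ∈ Finset.range (n + 1), n.choose j *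
      ((j + 1) * (treeCount P₁ (Fin (n - j + 1)) 0 * treeCount Q (Fin (j + 1)) 0)) := by
  classical
  let V := Fin (n + 2)
  let s : Finset (Σ _ : Finset V, V) :=
    ({U : Finset V | 1 ∈ U ∧ 0 ∉ U} : Finset _).sigma fun U => U
  have hs : ∀ i, i ∈ s ↔ ((1 : V) ∈ i.1 ∧ (0 : V) ∉ i.1) ∧ i.2 ∈ i.1 := by
    intro i
    simp [s]
  have h01 : (0 : V) ≠ 1 := by simp [V]
  have hsum := card_eq_sum_of_existsUnique s
    (fun p : SimpleGraph V × Set V => p.1.IsTree ∧ P V 0 p.1 p.2)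
    (fun i p => p.1.CrossBy i.1 (fun x y => x = i.2 ∧ y = 0) ∧ p.1.IsTree ∧ P V 0 p.1 p.2)
    (fun i _ p hp => hp.2)
    (fun p hp => by
      obtain ⟨U, c, hv, hc⟩ := hp.1.exists_isCut h01
      have hcU := hc.1
      have hrU := hc.2.1
      refine ⟨⟨U.toFinset, c⟩, (hs _).2 (by simp [hv, hcU, hrU]), ?_, hp⟩
      simpa using hc.2.2)
    (fun p hp i hi j hj hpi hpj => by
      rw [hs] at hi hj
      have := hp.1.isCut_unique (U := (i.1 : Set V)) (U' := (j.1 : Set V)) hi.1.1 hj.1.1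
        ⟨hi.2, hi.1.2, hpi.1⟩ ⟨hj.2, hj.1.2, hpj.1⟩
      obtain ⟨U, c⟩ := i
      obtain ⟨U', c'⟩ := j
      simp only [Finset.coe_inj] at this
      obtain ⟨rfl, rfl⟩ := this
      rfl)
  rw [treeCount, hsum, Finset.sum_sigma]
  have hterm : ∀ U : Finset V, 1 ∈ U ∧ 0 ∉ U → ∀ c ∈ U,
      Nat.card {p : SimpleGraph V × Set V //
        p.1.CrossBy U (fun x y => x = c ∧ y = 0) ∧ p.1.IsTree ∧ P V 0 p.1 p.2} =
      treeCount P₁ (Fin (n + 2 - U.card - 1 + 1)) 0 * treeCount Q (Fin (U.card - 1 + 1)) 0 := by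
    intro U hU c hc
    have hUpos : 0 < U.card := Finset.card_pos.2 ⟨c, hc⟩
    have hUlt : U.card < n + 2 := by
      have := Finset.card_lt_univ_of_notMem hU.2
      simpa [V] using this
    rw [card_crossBy (U : Set V) _ _
      (fun p => p.1.IsTree ∧ P₁ _ ⟨0, by simpa using hU.2⟩ p.1 p.2)
      (fun p => p.1.IsTree ∧ Q _ ⟨c, by simpa using hc⟩ p.1 p.2)]
    · congr 1
      · refine treeCount_eq h₁ ?_ _
        rw [Fintype.card_compl_set]
        simp [V]
        omega
      · refine treeCount_eq hQ ?_ _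
        simp
        omega
    · intro p hp
      have hcut : p.1.IsCut U c 0 := ⟨by simpa using hc, by simpa using hU.2, hp⟩
      rw [hcut.isTree_iff, h p.1 U c 0 p.2 hcut]
      simp only [restrictPair]
      tauto
  rw [Finset.sum_congr rfl fun U hU => Finset.sum_congr rfl fun c hc =>
    hterm U (by simpa using hU) c hc]
  simp only [Finset.sum_const, smul_eq_mul]
  rw [sum_filter_mem_notMem (n := n) (by simp [V]) h01 (fun k => k *
    (treeCount P₁ (Fin (n + 2 - k - 1 + 1)) 0 * treeCount Q (Fin (k - 1 + 1)) 0))]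
  refine Finset.sum_congr rfl fun j hj => ?_
  rw [show n + 2 - (j + 1) - 1 = n - j by omega, show j + 1 - 1 = j by omega]

theorem forestCount_succ {P : ∀ V : Type, SimpleGraph V → Set V → Prop}
    (hP : RootedPred.Invariant fun V _ => P V)
    (hemp : ∀ (V : Type) [IsEmpty V] G J, P V G J)
    (h : ∀ ⦃V : Type⦄ (G : SimpleGraph V) (U : Set V) (J : Set V),
      G.CrossBy U (fun _ _ => False) → (P V G J ↔ P ↥Uᶜ (G.induce Uᶜ) (Subtype.val ⁻¹' J) ∧
        P U (G.induce U) (Subtype.val ⁻¹' J))) (n : ℕ) :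
    forestCount P (Fin (n + 1)) = ∑ j ∈ Finset.range (n + 1), n.choose j *
      (forestCount P (Fin (n - j)) * treeCount (fun V _ => P V) (Fin (j + 1)) 0) := by
  classical
  let V := Fin (n + 1)
  have hfc : ∀ (W : Type) [Fintype W] (k : ℕ), Fintype.card W = k →
      forestCount P W = forestCount P (Fin k) := by
    intro W _ k hk
    have e := Fintype.equivFinOfCardEq hk
    refine (Nat.card_congr ((comapPairEquiv e).subtypeEquiv fun p => ?_)).symm
    refine and_congr (Iso.comap e p.1).isAcyclic_iff.symm ?_
    rcases isEmpty_or_nonempty W with hW | ⟨⟨r⟩⟩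
    · have : IsEmpty (Fin k) := e.symm.isEmpty
      exact iff_of_true (hemp _ _ _) (hemp _ _ _)
    · exact (hP e r p.1 p.2).symm
  let s : Finset (Finset V) := {U | 0 ∈ U}
  have hs : ∀ U, U ∈ s ↔ (0 : V) ∈ U := by simp [s]
  have hsum := card_eq_sum_of_existsUnique s
    (fun p : SimpleGraph V × Set V => p.1.IsAcyclic ∧ P V p.1 p.2)
    (fun U p => p.1.CrossBy U (fun _ _ => False) ∧ (p.1.induce (U : Set V)).Connected ∧
      p.1.IsAcyclic ∧ P V p.1 p.2)
    (fun i _ p hp => hp.2.2)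
    (fun p hp => by
      refine ⟨{x | p.1.Reachable 0 x}.toFinset, (hs _).2 (by simp), ?_, ?_, hp⟩
      · simpa using crossBy_connectedComponent p.1 0
      · have := connected_induce_reachable p.1 0
        convert! this <;> simp)
    (fun p hp U hU U' hU' h h' => by
      rw [hs] at hU hU'
      have h1 := h.1.eq_reachable (v := 0) (by simpa using hU) h.2.1
      have h2 := h'.1.eq_reachable (v := 0) (by simpa using hU') h'.2.1
      exact Finset.coe_injective (h1.trans h2.symm))
  rw [forestCount, hsum]
  have hterm : ∀ U ∈ s, Nat.card {p : SimpleGraph V × Set V // p.1.CrossBy U (fun _ _ => False) ∧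
      (p.1.induce (U : Set V)).Connected ∧ p.1.IsAcyclic ∧ P V p.1 p.2} =
      forestCount P (Fin (n + 1 - U.card)) *
        treeCount (fun V _ => P V) (Fin (U.card - 1 + 1)) 0 := by
    intro U hU
    rw [hs] at hU
    have hUpos : 0 < U.card := Finset.card_pos.2 ⟨0, hU⟩
    rw [card_crossBy (U : Set V) _ _
      (fun p => p.1.IsAcyclic ∧ P _ p.1 p.2) (fun p => p.1.IsTree ∧ P _ p.1 p.2)]
    · congr 1
      · refine hfc _ _ ?_
        rw [Fintype.card_compl_set]
        simp [V]
      · refine treeCount_eq hP ?_ (⟨0, by simpa using hU⟩ : (U : Set V))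
        simp
        omega
    · intro p hp
      rw [hp.isAcyclic_iff, h p.1 U p.2 hp]
      simp only [restrictPair, isTree_iff]
      tauto
  rw [Finset.sum_congr rfl hterm, sum_filter_mem (n := n) (by simp [V]) 0
    (fun k => forestCount P (Fin (n + 1 - k)) *
        treeCount (fun V _ => P V) (Fin (k - 1 + 1)) 0)]
  refine Finset.sum_congr rfl fun j hj => ?_
  rw [show n + 1 - (j + 1) = n - j by omega, show j + 1 - 1 = j by omega]

end SimpleGraph

namespace SimpleGraph

/-- `w` lies in `J` or has a neighbour in `J`. -/
def Dominates {V : Type*} (G : SimpleGraph V) (J : Set V) (w : V) : Prop :=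
  w ∈ J ∨ ∃ u ∈ J, G.Adj w u

/-- Independent sets that dominate every vertex. -/
def indepDom (V : Type) (G : SimpleGraph V) (J : Set V) : Prop :=
  _root_.IsIndepSet G J ∧ ∀ w, Dominates G J w

/-- Independent sets that contain the root and dominate every vertex. -/
def rootMem : RootedPred := fun _ r G J =>
  _root_.IsIndepSet G J ∧ r ∈ J ∧ ∀ w, w ≠ r → Dominates G J w

/-- Independent sets that avoid the root and dominate every other vertex. -/
def rootNotMem : RootedPred := fun _ r G J =>
  _root_.IsIndepSet G J ∧ r ∉ J ∧ ∀ w, w ≠ r → Dominates G J w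

/-- Independent sets that avoid the root and dominate every vertex. -/
def rootDom : RootedPred := fun _ r G J => _root_.IsIndepSet G J ∧ r ∉ J ∧ ∀ w, Dominates G J w

/-- Independent sets that dominate exactly the vertices other than the root. -/
def rootUndom : RootedPred := fun _ r G J =>
  _root_.IsIndepSet G J ∧ ¬ Dominates G J r ∧ ∀ w, w ≠ r → Dominates G J w

lemma isIndepSet_comap {V W : Type*} (e : V ≃ W) (G : SimpleGraph W) (J : Set W) :
    _root_.IsIndepSet (G.comap e) (e ⁻¹' J) ↔ _root_.IsIndepSet G J := by
  constructor
  · intro h u v hu hv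
    have := @h (e.symm u) (e.symm v) (by simpa using hu) (by simpa using hv)
    simpa using this
  · intro h u v hu hv
    exact h hu hv

lemma dominates_comap {V W : Type*} (e : V ≃ W) (G : SimpleGraph W) (J : Set W) (v : V) :
    Dominates (G.comap e) (e ⁻¹' J) v ↔ Dominates G J (e v) := by
  simp only [Dominates, Set.mem_preimage, comap_adj]
  rw [e.exists_congr_left]
  simp

lemma indepDom_invariant : RootedPred.Invariant fun V _ => indepDom V := by
  intro V W e r G J
  simp only [indepDom, isIndepSet_comap, dominates_comap, e.forall_congr_left, e.apply_symm_apply]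

lemma rootMem_invariant : rootMem.Invariant := by
  intro V W e r G J
  simp only [rootMem, isIndepSet_comap, dominates_comap, e.forall_congr_left, e.apply_symm_apply,
    Set.mem_preimage, ne_eq, e.symm_apply_eq]

lemma rootNotMem_invariant : rootNotMem.Invariant := by
  intro V W e r G J
  simp only [rootNotMem, isIndepSet_comap, dominates_comap, e.forall_congr_left,
    e.apply_symm_apply, Set.mem_preimage, ne_eq, e.symm_apply_eq]

lemma rootDom_invariant : rootDom.Invariant := by
  intro V W e r G J
  simp only [rootDom, isIndepSet_comap, dominates_comap, e.forall_congr_left, e.apply_symm_apply,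
    Set.mem_preimage]

lemma rootUndom_invariant : rootUndom.Invariant := by
  intro V W e r G J
  simp only [rootUndom, isIndepSet_comap, dominates_comap, e.forall_congr_left,
    e.apply_symm_apply, ne_eq, e.symm_apply_eq]

section Cut

variable {V : Type*} {G : SimpleGraph V} {U : Set V} {J : Set V} {c r : V}

lemma Dominates.of_induce {w : U} (h : Dominates (G.induce U) (Subtype.val ⁻¹' J) w) :
    Dominates G J w := by
  rcases h with h | ⟨u, hu, hadj⟩
  · exact .inl h
  · exact .inr ⟨u, hu, hadj⟩

lemma isIndepSet_induce_preimage (h : _root_.IsIndepSet G J) :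
    _root_.IsIndepSet (G.induce U) (Subtype.val ⁻¹' J) :=
  fun _ _ hu hv hadj => h hu hv hadj

lemma IsCut.dominates_iff (h : G.IsCut U c r) (w : U) (hw : (w : V) ≠ c ∨ r ∉ J) :
    Dominates G J w ↔ Dominates (G.induce U) (Subtype.val ⁻¹' J) w := by
  refine ⟨?_, Dominates.of_induce⟩
  rintro (hJ | ⟨u, hu, hadj⟩)
  · exact .inl hJ
  · by_cases huU : u ∈ U
    · exact .inr ⟨⟨u, huU⟩, hu, hadj⟩
    · have := (h.2.2 w.2 huU).1 hadj
      rcases hw with hw | hw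
      · exact absurd this.1 hw
      · exact absurd (this.2 ▸ hu) hw

lemma IsCut.dominates_of_mem (h : G.IsCut U c r) (hr : r ∈ J) : Dominates G J c :=
  .inr ⟨r, hr, h.adj⟩

lemma IsCut.isIndepSet_iff (h : G.IsCut U c r) :
    _root_.IsIndepSet G J ↔ ¬ (r ∈ J ∧ c ∈ J) ∧
      _root_.IsIndepSet (G.induce Uᶜ) (Subtype.val ⁻¹' J) ∧
      _root_.IsIndepSet (G.induce U) (Subtype.val ⁻¹' J) := by
  refine ⟨fun hI => ⟨fun hh => hI hh.1 hh.2 h.adj.symm, isIndepSet_induce_preimage hI,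
    isIndepSet_induce_preimage hI⟩, ?_⟩
  rintro ⟨h1, h2, h3⟩ u v hu hv hadj
  by_cases huU : u ∈ U <;> by_cases hvU : v ∈ U
  · exact @h3 ⟨u, huU⟩ ⟨v, hvU⟩ hu hv hadj
  · obtain ⟨rfl, rfl⟩ := (h.2.2 huU hvU).1 hadj
    exact h1 ⟨hv, hu⟩
  · obtain ⟨rfl, rfl⟩ := (h.2.2 hvU huU).1 hadj.symm
    exact h1 ⟨hu, hv⟩
  · exact @h2 ⟨u, huU⟩ ⟨v, hvU⟩ hu hv hadj

lemma forall_iff_compl_and (U : Set V) (p : V → Prop) :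
    (∀ w, p w) ↔ (∀ w : ↥Uᶜ, p w) ∧ ∀ w : U, p w := by
  refine ⟨fun h => ⟨fun w => h w, fun w => h w⟩, fun h w => ?_⟩
  by_cases hw : w ∈ U
  · exact h.2 ⟨w, hw⟩
  · exact h.1 ⟨w, hw⟩

/-- Domination away from the root, split along a cut. -/
lemma IsCut.forall_dominates_iff (h : G.IsCut U c r) :
    (∀ w, w ≠ r → Dominates G J w) ↔
      (∀ w : ↥Uᶜ, w ≠ ⟨r, h.2.1⟩ → Dominates (G.induce Uᶜ) (Subtype.val ⁻¹' J) w) ∧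
      (∀ w : U, w ≠ ⟨c, h.1⟩ ∨ r ∉ J → Dominates (G.induce U) (Subtype.val ⁻¹' J) w) := by
  rw [forall_iff_compl_and U]
  refine and_congr (forall_congr' fun w => ?_) (forall_congr' fun w => ?_)
  · have : w ≠ ⟨r, h.2.1⟩ ↔ (w : V) ≠ r := by simp [Subtype.ext_iff]
    rw [this]
    exact imp_congr_right fun hw => h.compl.dominates_iff w (.inl hw)
  · have hwr : (w : V) ≠ r := fun hw => h.2.1 (hw ▸ w.2)
    have : w ≠ ⟨c, h.1⟩ ↔ (w : V) ≠ c := by simp [Subtype.ext_iff]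
    rw [this]
    simp only [hwr, ne_eq, not_false_eq_true, true_imp_iff]
    refine ⟨fun hd hw => (h.dominates_iff w hw).1 hd, fun hd => ?_⟩
    by_cases hw : (w : V) ≠ c ∨ r ∉ J
    · exact (h.dominates_iff w hw).2 (hd hw)
    · push Not at hw
      rw [hw.1]
      exact h.dominates_of_mem hw.2

lemma IsCut.not_dominates_iff (h : G.IsCut U c r) :
    ¬ Dominates G J r ↔
      ¬ Dominates (G.induce Uᶜ) (Subtype.val ⁻¹' J) ⟨r, h.2.1⟩ ∧ c ∉ J := by
  by_cases hc : c ∈ J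
  · simp only [hc, not_true_eq_false, and_false, iff_false, not_not]
    exact h.compl.dominates_of_mem hc
  · rw [← h.compl.dominates_iff ⟨r, h.2.1⟩ (.inr hc)]
    simp [hc]

end Cut

lemma rootMem_splits : rootMem.Splits rootMem rootNotMem := by
  intro V G U c r J h
  simp only [rootMem, rootNotMem, h.isIndepSet_iff, Set.mem_preimage]
  by_cases hr : r ∈ J
  · by_cases hc : c ∈ J
    · simp [hr, hc]
    · rw [h.forall_dominates_iff]
      simp only [hr, not_true_eq_false, or_false]
      tauto
  · simp [hr]

lemma rootUndom_splits : rootUndom.Splits rootUndom rootDom := by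
  intro V G U c r J h
  simp only [rootUndom, rootDom, h.isIndepSet_iff, Set.mem_preimage, h.not_dominates_iff]
  by_cases hr : r ∈ J
  · have : Dominates (G.induce Uᶜ) (Subtype.val ⁻¹' J) ⟨r, h.2.1⟩ := .inl hr
    simp [this]
  · rw [h.forall_dominates_iff]
    simp only [hr, not_false_eq_true, or_true, true_imp_iff]
    tauto

lemma rootNotMem_splits : rootNotMem.Splits rootNotMem fun V _ => indepDom V := by
  intro V G U c r J h
  simp only [rootNotMem, indepDom, h.isIndepSet_iff, Set.mem_preimage]
  by_cases hr : r ∈ J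
  · simp [hr]
  · rw [h.forall_dominates_iff]
    simp only [hr, not_false_eq_true, or_true, true_imp_iff]
    tauto

/-- The property used to count graphs without a vertex set. -/
def noSet (V : Type) (_ : SimpleGraph V) (J : Set V) : Prop := J = ∅

lemma noSet_invariant : RootedPred.Invariant fun V _ => noSet V := by
  intro V W e r G J
  simp [noSet, Set.preimage_eq_empty_iff]

lemma noSet_iff {V : Type} (U : Set V) (G : SimpleGraph V) (J : Set V) :
    noSet V G J ↔ noSet ↥Uᶜ (G.induce Uᶜ) (Subtype.val ⁻¹' J) ∧
      noSet U (G.induce U) (Subtype.val ⁻¹' J) := by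
  simp only [noSet, Set.eq_empty_iff_forall_notMem, Set.mem_preimage]
  exact forall_iff_compl_and U _

lemma noSet_splits : RootedPred.Splits (fun V _ => noSet V) (fun V _ => noSet V)
    fun V _ => noSet V := fun _ G U _ _ J _ => noSet_iff U G J

lemma CrossBy.indepDom_iff {V : Type} {G : SimpleGraph V} {U : Set V} {J : Set V}
    (h : G.CrossBy U fun _ _ => False) :
    indepDom V G J ↔ indepDom ↥Uᶜ (G.induce Uᶜ) (Subtype.val ⁻¹' J) ∧
      indepDom U (G.induce U) (Subtype.val ⁻¹' J) := by
  have hI : _root_.IsIndepSet G J ↔ _root_.IsIndepSet (G.induce Uᶜ) (Subtype.val ⁻¹' J) ∧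
      _root_.IsIndepSet (G.induce U) (Subtype.val ⁻¹' J) := by
    refine ⟨fun hI => ⟨isIndepSet_induce_preimage hI, isIndepSet_induce_preimage hI⟩, ?_⟩
    rintro ⟨h2, h3⟩ u v hu hv hadj
    by_cases huU : u ∈ U <;> by_cases hvU : v ∈ U
    · exact @h3 ⟨u, huU⟩ ⟨v, hvU⟩ hu hv hadj
    · exact (h huU hvU).1 hadj
    · exact (h hvU huU).1 hadj.symm
    · exact @h2 ⟨u, huU⟩ ⟨v, hvU⟩ hu hv hadj
  have hD : ∀ {U : Set V}, (G.CrossBy U fun _ _ => False) → ∀ w : U,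
      (Dominates G J w ↔ Dominates (G.induce U) (Subtype.val ⁻¹' J) w) := by
    intro U h w
    refine ⟨?_, Dominates.of_induce⟩
    rintro (hJ | ⟨u, hu, hadj⟩)
    · exact .inl hJ
    · by_cases huU : u ∈ U
      · exact .inr ⟨⟨u, huU⟩, hu, hadj⟩
      · exact ((h w.2 huU).1 hadj).elim
  simp only [indepDom, hI, forall_iff_compl_and U, hD h, hD h.compl]
  tauto

lemma card_subtype_add {α : Type*} [Finite α] (Φ Φ₁ Φ₂ : α → Prop)
    (h : ∀ a, Φ a ↔ Φ₁ a ∨ Φ₂ a) (hd : ∀ a, Φ₁ a → ¬ Φ₂ a) :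
    Nat.card {a // Φ a} = Nat.card {a // Φ₁ a} + Nat.card {a // Φ₂ a} := by
  classical
  have := Fintype.ofFinite α
  simp only [Nat.card_eq_fintype_card, Fintype.card_subtype]
  rw [← Finset.card_union_of_disjoint]
  · congr 1
    ext a
    simp [h]
  · rw [Finset.disjoint_left]
    simpa using hd

lemma treeCount_indepDom (n : ℕ) : treeCount (fun V _ => indepDom V) (Fin (n + 1)) 0 =
    treeCount rootMem (Fin (n + 1)) 0 + treeCount rootDom (Fin (n + 1)) 0 := by
  refine card_subtype_add _ _ _ (fun p => ?_) (fun p h1 h2 => h2.2.2.1 h1.2.2.1)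
  have : p.1.IsTree ∧ rootMem _ 0 p.1 p.2 ↔
      p.1.IsTree ∧ _root_.IsIndepSet p.1 p.2 ∧ 0 ∈ p.2 ∧ ∀ w, Dominates p.1 p.2 w := by
    refine and_congr_right fun _ => and_congr_right fun _ => and_congr_right fun h0 =>
      forall_congr' fun w => ?_
    by_cases hw : w = 0
    · simp only [hw, ne_eq, not_true_eq_false, false_imp_iff, true_iff]
      exact .inl h0
    · simp [hw]
  rw [this]
  simp only [indepDom, rootDom]
  tauto

lemma treeCount_rootNotMem (n : ℕ) : treeCount rootNotMem (Fin (n + 1)) 0 =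
    treeCount rootDom (Fin (n + 1)) 0 + treeCount rootUndom (Fin (n + 1)) 0 := by
  refine card_subtype_add _ _ _ (fun p => ?_) (fun p h1 h2 => h2.2.2.1 (h1.2.2.2 0))
  have h1 : rootUndom _ 0 p.1 p.2 ↔ _root_.IsIndepSet p.1 p.2 ∧ 0 ∉ p.2 ∧ ¬ Dominates p.1 p.2 0 ∧
      ∀ w, w ≠ 0 → Dominates p.1 p.2 w := by
    have : ¬ Dominates p.1 p.2 0 → 0 ∉ p.2 := fun h h0 => h (.inl h0)
    simp only [rootUndom]
    tauto
  have h2 : (∀ w, Dominates p.1 p.2 w) ↔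
      Dominates p.1 p.2 0 ∧ ∀ w, w ≠ 0 → Dominates p.1 p.2 w := by
    refine ⟨fun h => ⟨h 0, fun w _ => h w⟩, fun h w => ?_⟩
    by_cases hw : w = 0
    · exact hw ▸ h.1
    · exact h.2 w hw
  simp only [rootNotMem, rootDom, h1, h2]
  tauto

lemma treeCount_one (P : RootedPred) (J₀ : Set (Fin 1))
    (h : ∀ J, P (Fin 1) 0 ⊥ J ↔ J = J₀) : treeCount P (Fin 1) 0 = 1 := by
  rw [treeCount, Nat.card_eq_one_iff_unique]
  have hG : ∀ G : SimpleGraph (Fin 1), G = ⊥ := fun G => Subsingleton.elim _ _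
  refine ⟨⟨fun p q => Subtype.ext (Prod.ext (Subsingleton.elim _ _) ?_)⟩,
    ⟨⟨(⊥, J₀), IsTree.of_subsingleton, (h _).2 rfl⟩⟩⟩
  have hp := p.2.2
  have hq := q.2.2
  rw [hG p.1.1, h] at hp
  rw [hG q.1.1, h] at hq
  rw [hp, hq]

lemma treeCount_rootMem_one : treeCount rootMem (Fin 1) 0 = 1 := by
  refine treeCount_one _ Set.univ fun J => ?_
  simp [rootMem, _root_.IsIndepSet, Set.eq_univ_iff_forall]

lemma treeCount_rootUndom_one : treeCount rootUndom (Fin 1) 0 = 1 := by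
  refine treeCount_one _ ∅ fun J => ?_
  simp [rootUndom, _root_.IsIndepSet, Dominates, Set.eq_empty_iff_forall_notMem]

lemma treeCount_rootNotMem_one : treeCount rootNotMem (Fin 1) 0 = 1 := by
  refine treeCount_one _ ∅ fun J => ?_
  simp [rootNotMem, _root_.IsIndepSet, Set.eq_empty_iff_forall_notMem]

lemma treeCount_noSet_one : treeCount (fun V _ => noSet V) (Fin 1) 0 = 1 :=
  treeCount_one _ ∅ fun _ => Iff.rfl

lemma isMaximalIndepSet_iff_indepDom {V : Type} (G : SimpleGraph V) (J : Set V) :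
    _root_.IsMaximalIndepSet G J ↔ indepDom V G J := by
  refine and_congr_right fun hI => ⟨fun h w => ?_, fun h J' hJ' hss => ?_⟩
  · by_contra hw
    simp only [Dominates, not_or, not_exists, not_and] at hw
    refine h (insert w J) ?_ (Set.ssubset_insert hw.1)
    rintro u v (rfl | hu) (rfl | hv) hadj
    · exact hadj.ne rfl
    · exact hw.2 v hv hadj
    · exact hw.2 u hu hadj.symm
    · exact hI hu hv hadj
  · obtain ⟨w, hw, hwJ⟩ := Set.exists_of_ssubset hss
    rcases h w with h | ⟨u, hu, hadj⟩
    · exact hwJ h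
    · exact hJ' hw (hss.1 hu) hadj

lemma iN_eq_forestCount (n : ℕ) : iN n = forestCount indepDom (Fin n) :=
  Nat.card_congr (Equiv.subtypeEquivRight fun p =>
    and_congr_right fun _ => isMaximalIndepSet_iff_indepDom p.1 p.2)

lemma fN_eq_forestCount (n : ℕ) : fN n = forestCount noSet (Fin n) :=
  Nat.card_congr
    { toFun := fun G => ⟨(G.1, ∅), G.2, rfl⟩
      invFun := fun p => ⟨p.1.1, p.2.1⟩
      left_inv := fun _ => rfl
      right_inv := fun p => Subtype.ext (Prod.ext rfl p.2.2.symm) }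

lemma forestCount_zero (P : ∀ V : Type, SimpleGraph V → Set V → Prop)
    (hemp : ∀ (V : Type) [IsEmpty V] G J, P V G J) : forestCount P (Fin 0) = 1 := by
  rw [forestCount, Nat.card_eq_one_iff_unique]
  exact ⟨inferInstance, ⟨⟨(⊥, ∅), IsAcyclic.of_subsingleton, hemp _ _ _⟩⟩⟩

lemma indepDom_of_isEmpty (V : Type) [IsEmpty V] (G : SimpleGraph V) (J : Set V) :
    indepDom V G J :=
  ⟨fun u => isEmptyElim u, fun w => isEmptyElim w⟩

lemma noSet_of_isEmpty (V : Type) [IsEmpty V] (G : SimpleGraph V) (J : Set V) :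
    noSet V G J := Subsingleton.elim _ _

end SimpleGraph


open scoped PowerSeries in
/-- The Taylor series at the origin of a function on `ℂ`. -/
noncomputable def taylorPowerSeries (f : ℂ → ℂ) : ℂ⟦X⟧ :=
  PowerSeries.mk fun n => iteratedDeriv n f 0 / n.factorial

namespace taylorPowerSeries

variable {f g : ℂ → ℂ}

lemma coeff_eq (f : ℂ → ℂ) (n : ℕ) :
    (taylorPowerSeries f).coeff n = iteratedDeriv n f 0 / n.factorial :=
  PowerSeries.coeff_mk _ _

lemma coeff_zero (f : ℂ → ℂ) : (taylorPowerSeries f).coeff 0 = f 0 := by simp [coeff_eq]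

lemma congr (h : f =ᶠ[𝓝 0] g) : taylorPowerSeries f = taylorPowerSeries g := by
  ext n
  rw [coeff_eq, coeff_eq, h.iteratedDeriv_eq]

lemma add (hf : AnalyticAt ℂ f 0) (hg : AnalyticAt ℂ g 0) :
    taylorPowerSeries (f + g) = taylorPowerSeries f + taylorPowerSeries g := by
  ext n
  rw [map_add, coeff_eq, coeff_eq, coeff_eq, iteratedDeriv_add hf.contDiffAt hg.contDiffAt,
    add_div]

lemma sub (hf : AnalyticAt ℂ f 0) (hg : AnalyticAt ℂ g 0) :
    taylorPowerSeries (f - g) = taylorPowerSeries f - taylorPowerSeries g := by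
  ext n
  rw [map_sub, coeff_eq, coeff_eq, coeff_eq, iteratedDeriv_sub hf.contDiffAt hg.contDiffAt,
    sub_div]

lemma mul (hf : AnalyticAt ℂ f 0) (hg : AnalyticAt ℂ g 0) :
    taylorPowerSeries (f * g) = taylorPowerSeries f * taylorPowerSeries g := by
  ext n
  rw [PowerSeries.coeff_mul, coeff_eq, iteratedDeriv_mul hf.contDiffAt hg.contDiffAt,
    Finset.Nat.sum_antidiagonal_eq_sum_range_succ_mk, Finset.sum_div]
  refine Finset.sum_congr rfl fun i hi => ?_
  have hi : i ≤ n := Nat.lt_succ_iff.1 (Finset.mem_range.1 hi)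
  rw [coeff_eq, coeff_eq, Nat.cast_choose ℂ hi]
  have := Nat.cast_ne_zero (R := ℂ).2 n.factorial_ne_zero
  field_simp

lemma deriv_eq (f : ℂ → ℂ) :
    taylorPowerSeries (deriv f) = PowerSeries.derivative ℂ (taylorPowerSeries f) := by
  ext n
  rw [PowerSeries.coeff_derivative, coeff_eq, coeff_eq, iteratedDeriv_succ', Nat.factorial_succ]
  have : (n : ℂ) + 1 ≠ 0 := Nat.cast_add_one_ne_zero n
  push_cast
  field_simp

lemma const_eq (c : ℂ) : taylorPowerSeries (fun _ => c) = PowerSeries.C c := by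
  ext n
  rw [coeff_eq, iteratedDeriv_const, PowerSeries.coeff_C]
  split_ifs with h <;> simp [h]

lemma id_eq : taylorPowerSeries (fun z => z) = PowerSeries.X := by
  ext n
  rw [coeff_eq, PowerSeries.coeff_X]
  rcases n with _ | n
  · simp
  · rw [iteratedDeriv_succ', deriv_id'', iteratedDeriv_const]
    split_ifs with h h' h' <;> simp_all

lemma coeff_succ_id_mul (hf : AnalyticAt ℂ f 0) (n : ℕ) :
    (taylorPowerSeries fun z => z * f z).coeff (n + 1) = (taylorPowerSeries f).coeff n := by
  have h : AnalyticAt ℂ (fun z : ℂ => z) 0 := analyticAt_id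
  rw [show (fun z => z * f z) = (fun z => z) * f from rfl, mul h hf, id_eq,
    PowerSeries.coeff_succ_X_mul]

lemma coeff_const_mul (c : ℂ) (hf : AnalyticAt ℂ f 0) (n : ℕ) :
    (taylorPowerSeries fun z => c * f z).coeff n = c * (taylorPowerSeries f).coeff n := by
  rw [show (fun z => c * f z) = (fun _ => c) * f from rfl, mul analyticAt_const hf, const_eq,
    PowerSeries.coeff_C_mul]

/-- The Taylor coefficients of `exp (z * f z)`. -/
lemma succ_mul_coeff_exp (hf : AnalyticAt ℂ f 0) (hg : g =ᶠ[𝓝 0] fun z => Complex.exp (z * f z))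
    (n : ℕ) : (n + 1) * (taylorPowerSeries g).coeff (n + 1) =
      ∑ j ∈ Finset.range (n + 1), (taylorPowerSeries g).coeff (n - j) *
        ((j + 1) * (taylorPowerSeries f).coeff j) := by
  set φ : ℂ → ℂ := fun z => z * f z with hφ
  have hφa : AnalyticAt ℂ φ 0 := analyticAt_id.mul hf
  have hga : AnalyticAt ℂ g 0 := (AnalyticAt.cexp hφa).congr hg.symm
  have hd : deriv g =ᶠ[𝓝 0] g * deriv φ := by
    filter_upwards [hg.deriv, hg, hφa.eventually_analyticAt] with z h₁ h₂ h₃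
    rw [h₁, Pi.mul_apply, h₂]
    exact h₃.differentiableAt.hasDerivAt.cexp.deriv
  have h := congrArg (PowerSeries.coeff n) (deriv_eq g)
  rw [congr hd, mul hga hφa.deriv, deriv_eq, PowerSeries.coeff_derivative, PowerSeries.coeff_mul,
    ← Finset.Nat.sum_antidiagonal_swap, Finset.Nat.sum_antidiagonal_eq_sum_range_succ_mk] at h
  rw [mul_comm, ← h]
  refine Finset.sum_congr rfl fun j _ => ?_
  rw [Prod.fst_swap, Prod.snd_swap, PowerSeries.coeff_derivative, coeff_succ_id_mul hf,
    mul_comm ((j : ℂ) + 1)]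

/-- **Lagrange inversion**, change of variables form: the substitution `u * exp (-g u)`. -/
lemma coeff_comp_mul (hg : AnalyticAt ℂ g 0) (n : ℕ) :
    ∀ f : ℂ → ℂ, AnalyticAt ℂ f 0 →
      (taylorPowerSeries fun u => f (u * Complex.exp (-g u)) *
        ((1 - u * deriv g u) * Complex.exp (n * g u))).coeff n = (taylorPowerSeries f).coeff n := by
  set X : ℂ → ℂ := fun u => u * Complex.exp (-g u) with hX
  have hXa : AnalyticAt ℂ X 0 := analyticAt_id.mul hg.neg.cexp
  have hX0 : X 0 = 0 := by simp [hX]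
  have hE (c : ℂ) : AnalyticAt ℂ (fun u => Complex.exp (c * g u)) 0 :=
    (analyticAt_const.mul hg).cexp
  have hJ : AnalyticAt ℂ (fun u => 1 - u * deriv g u) 0 :=
    analyticAt_const.sub (analyticAt_id.mul hg.deriv)
  induction n with
  | zero => intro f hf; simp [coeff_zero]
  | succ n ih =>
    intro f hf
    set f₁ := dslope f 0 with hf₁
    have hf₁a : AnalyticAt ℂ f₁ 0 := by
      obtain ⟨p, hp⟩ := hf
      exact hp.has_fpower_series_dslope_fslope.analyticAt
    have hff (z : ℂ) : f z = f 0 + z * f₁ z := by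
      have := sub_smul_dslope f 0 z
      simp only [sub_zero, smul_eq_mul] at this
      rw [hf₁, this]; ring
    have hfX : AnalyticAt ℂ (fun u => f₁ (X u)) 0 :=
      AnalyticAt.fun_comp (by rwa [hX0]) hXa
    have hw : deriv (fun u => Complex.exp ((n + 1 : ℕ) * g u)) =ᶠ[𝓝 0]
        (fun u => (n + 1 : ℕ) * deriv g u * Complex.exp ((n + 1 : ℕ) * g u)) := by
      filter_upwards [hg.eventually_analyticAt] with z hz
      rw [(hz.differentiableAt.hasDerivAt.const_mul ((n + 1 : ℕ) : ℂ)).cexp.deriv]; ring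
    set w : ℂ → ℂ := fun u => Complex.exp ((n + 1 : ℕ) * g u) with hwdef
    have hn : (n : ℂ) + 1 ≠ 0 := Nat.cast_add_one_ne_zero n
    have hc : (taylorPowerSeries ((fun u => 1 - u * deriv g u) * w)).coeff (n + 1) = 0 := by
      have h : (fun u => 1 - u * deriv g u) * w =ᶠ[𝓝 0]
          w - fun u => ((n : ℂ) + 1)⁻¹ * (u * deriv w u) := by
        filter_upwards [hw] with z hz
        rw [Pi.mul_apply, Pi.sub_apply, hz]
        simp only [hwdef]
        push_cast
        field_simp
      have hwa : AnalyticAt ℂ w 0 := hE _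
      have hw₁ : AnalyticAt ℂ (fun u => u * deriv w u) 0 := analyticAt_id.mul hwa.deriv
      have hw₂ : AnalyticAt ℂ (fun u => ((n : ℂ) + 1)⁻¹ * (u * deriv w u)) 0 :=
        analyticAt_const.mul hw₁
      rw [congr h, sub hwa hw₂, map_sub, coeff_const_mul _ hw₁, coeff_succ_id_mul hwa.deriv,
        deriv_eq,
        PowerSeries.coeff_derivative]
      field_simp
      ring
    have hsplit : (fun u => f (X u) * ((1 - u * deriv g u) * w u)) =
        (fun u => f 0 * ((fun u => 1 - u * deriv g u) * w) u) + fun u => u *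
          (f₁ (X u) * ((1 - u * deriv g u) * Complex.exp (n * g u))) := by
      ext u
      simp only [Pi.mul_apply, Pi.add_apply]
      rw [hff (X u), hwdef, hX]
      have : Complex.exp ((n + 1 : ℕ) * g u) = Complex.exp (n * g u) * Complex.exp (g u) := by
        rw [← Complex.exp_add]; push_cast; ring_nf
      have he : Complex.exp (-g u) * Complex.exp (g u) = 1 := by
        rw [← Complex.exp_add, neg_add_cancel, Complex.exp_zero]
      simp only [this]
      linear_combination (u * f₁ (u * Complex.exp (-g u)) * (1 - u * deriv g u) *
        Complex.exp (n * g u)) * he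
    have hfe : f = (fun _ => f 0) + fun u => u * f₁ u := by
      ext z; exact hff z
    have h₁ : AnalyticAt ℂ (fun u => f 0 * ((fun u => 1 - u * deriv g u) * w) u) 0 :=
      analyticAt_const.mul (hJ.mul (hE _))
    have h₀ : AnalyticAt ℂ (fun u =>
        f₁ (X u) * ((1 - u * deriv g u) * Complex.exp (n * g u))) 0 := hfX.mul (hJ.mul (hE _))
    have h₂ : AnalyticAt ℂ (fun u => u *
        (f₁ (X u) * ((1 - u * deriv g u) * Complex.exp (n * g u)))) 0 := analyticAt_id.mul h₀
    have h₃ : AnalyticAt ℂ (fun u => u * f₁ u) 0 := analyticAt_id.mul hf₁a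
    rw [hsplit, add h₁ h₂, map_add, coeff_const_mul _ (hJ.mul (hE _)),
      hc, mul_zero, zero_add, coeff_succ_id_mul h₀, ih f₁ hf₁a]
    conv_rhs => rw [hfe, add analyticAt_const h₃, const_eq, map_add,
      coeff_succ_id_mul hf₁a, PowerSeries.coeff_C]
    simp

/-- **Lagrange inversion**: the Taylor coefficients of a function given parametrically by
`f (u * exp (-g u)) = h u`. -/
lemma succ_mul_coeff_of_comp (hg : AnalyticAt ℂ g 0) {h : ℂ → ℂ} (hf : AnalyticAt ℂ f 0)
    (hfh : (fun u => f (u * Complex.exp (-g u))) =ᶠ[𝓝 0] h) (n : ℕ) :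
    (n + 1) * (taylorPowerSeries f).coeff (n + 1) =
      (taylorPowerSeries fun u => deriv h u * Complex.exp ((n + 1) * g u)).coeff n := by
  rw [mul_comm, ← PowerSeries.coeff_derivative, ← deriv_eq, ← coeff_comp_mul hg n _ hf.deriv]
  congr 1
  apply congr
  have hXa : AnalyticAt ℂ (fun u => u * Complex.exp (-g u)) 0 := analyticAt_id.mul hg.neg.cexp
  have hX0 : (fun u => u * Complex.exp (-g u)) 0 = 0 := by simp
  have hfX := hXa.continuousAt.eventually (by rw [hX0]; exact hf.eventually_analyticAt)
  filter_upwards [hfh.deriv, hfX, hg.eventually_analyticAt] with u h₁ h₂ h₃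
  have hgd := h₃.differentiableAt.hasDerivAt
  have hX := (hasDerivAt_id' u).fun_mul hgd.fun_neg.cexp
  have hc : HasDerivAt (fun u => f (u * Complex.exp (-g u))) _ u :=
    h₂.differentiableAt.hasDerivAt.comp u hX
  rw [← h₁, hc.deriv]
  have : Complex.exp ((n + 1) * g u) = Complex.exp (n * g u) * Complex.exp (g u) := by
    rw [← Complex.exp_add]; ring_nf
  have he : Complex.exp (-g u) * Complex.exp (g u) = 1 := by
    rw [← Complex.exp_add, neg_add_cancel, Complex.exp_zero]
  rw [this]
  linear_combination (-(deriv f (u * Complex.exp (-g u)) * (1 - u * deriv g u) *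
        Complex.exp (n * g u))) * he

end taylorPowerSeries

namespace taylorPowerSeries

lemma coeff_exp_eq_of_recurrence {f g : ℂ → ℂ} {p q : ℕ → ℂ} (hf : AnalyticAt ℂ f 0)
    (hg : g =ᶠ[𝓝 0] fun z => Complex.exp (z * f z)) {n : ℕ}
    (hp : (n + 1) * p (n + 1) = ∑ j ∈ Finset.range (n + 1), p (n - j) * ((j + 1) * q j))
    (hgp : ∀ j ≤ n, (taylorPowerSeries g).coeff j = p j)
    (hfq : ∀ j ≤ n, (taylorPowerSeries f).coeff j = q j) :
    (taylorPowerSeries g).coeff (n + 1) = p (n + 1) := by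
  refine mul_left_cancel₀ (Nat.cast_add_one_ne_zero (R := ℂ) n) ?_
  rw [succ_mul_coeff_exp hf hg, hp]
  refine Finset.sum_congr rfl fun j hj => ?_
  rw [hgp _ (Nat.sub_le n j), hfq _ (Nat.lt_succ_iff.1 (Finset.mem_range.1 hj))]

end taylorPowerSeries

lemma exists_analyticAt_inverse_mul_exp {g : ℂ → ℂ} (hg : AnalyticAt ℂ g 0) :
    ∃ D : ℂ → ℂ, AnalyticAt ℂ D 0 ∧ D 0 = 0 ∧ (∀ᶠ u in 𝓝 0, D (u * Complex.exp (-g u)) = u) ∧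
      ∀ᶠ x in 𝓝 0, x * Complex.exp (g (D x)) = D x := by
  set X : ℂ → ℂ := fun u => u * Complex.exp (-g u) with hX
  have hXa : AnalyticAt ℂ X 0 := analyticAt_id.mul hg.neg.cexp
  have hX0 : X 0 = 0 := by simp [hX]
  have hd : deriv X 0 ≠ 0 := by
    rw [((hasDerivAt_id' (0 : ℂ)).fun_mul
      hg.differentiableAt.hasDerivAt.fun_neg.cexp).deriv]
    simp
  have h₁ := hXa.analyticAt_localInverse hd
  have h₂ := hXa.hasStrictDerivAt.eventually_left_inverse hd
  have h₃ := hXa.hasStrictDerivAt.eventually_right_inverse hd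
  have h₄ : hXa.hasStrictDerivAt.localInverse _ _ _ hd (X 0) = 0 :=
    HasStrictFDerivAt.localInverse_apply_image ..
  rw [hX0] at h₁ h₃ h₄
  refine ⟨_, h₁, h₄, h₂, ?_⟩
  filter_upwards [h₃] with x hx
  generalize hXa.hasStrictDerivAt.localInverse _ _ _ hd x = y at hx
  rw [← hx, hX]
  simp only
  rw [mul_assoc, ← Complex.exp_add, neg_add_cancel, Complex.exp_zero, mul_one]

/-- The Taylor coefficients of the tree function, from the recurrence for rooted trees. -/
lemma succ_mul_eq_coeff_of_tree_recurrence {o : ℕ → ℂ} (h₀ : o 0 = 1)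
    (ho : ∀ n, (n + 1) * o (n + 1) = ∑ j ∈ Finset.range (n + 1), o (n - j) * ((j + 1) * o j))
    (n : ℕ) : (n + 1) * o n =
      (taylorPowerSeries fun u => Complex.exp ((n + 1) * u)).coeff n := by
  obtain ⟨D, hD, hD0, hl, hr⟩ := exists_analyticAt_inverse_mul_exp (g := fun u => u) analyticAt_id
  set f : ℂ → ℂ := fun x => Complex.exp (D x) with hf
  have hfa : AnalyticAt ℂ f 0 := hD.cexp
  have hff : f =ᶠ[𝓝 0] fun x => Complex.exp (x * f x) := by
    filter_upwards [hr] with x hx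
    rw [hf]
    simp only
    rw [hx]
  have hc (n : ℕ) : (taylorPowerSeries f).coeff n = o n := by
    induction n using Nat.strong_induction_on with
    | _ n ih =>
      rcases n with _ | n
      · rw [taylorPowerSeries.coeff_zero, h₀, hf]; simp [hD0]
      · exact taylorPowerSeries.coeff_exp_eq_of_recurrence hfa hff (ho n)
          (fun j hj => ih j (by omega)) fun j hj => ih j (by omega)
  have hfX : (fun u => (fun x => x * f x) (u * Complex.exp (-u))) =ᶠ[𝓝 0] fun u => u := by
    have hXc : Tendsto (fun u : ℂ => u * Complex.exp (-u)) (𝓝 0) (𝓝 0) :=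
      (Continuous.tendsto' (by fun_prop) _ _ (by simp))
    filter_upwards [hl, hXc.eventually hr] with u h₁ h₂
    rw [h₁] at h₂
    simp only [hf, h₁, h₂]
  have hxf : AnalyticAt ℂ (fun x => x * f x) 0 := analyticAt_id.mul hfa
  have h := taylorPowerSeries.succ_mul_coeff_of_comp (g := fun u => u) analyticAt_id hxf hfX n
  rw [← hc, ← taylorPowerSeries.coeff_succ_id_mul hfa]
  simpa using h

/-- The exponent governing the growth of trees with a maximal independent set. -/
noncomputable def misExponent (u : ℂ) : ℂ := u * (Complex.exp (u * Complex.exp u) - 1)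

/-- Rooted trees with a maximal independent set, in terms of the parameter `u`. -/
noncomputable def misTree (u : ℂ) : ℂ := u * Complex.exp u + misExponent u

/-- The Taylor coefficients of the generating function of rooted trees with a maximal independent
set, from the system of recurrences. -/
lemma succ_mul_eq_coeff_of_mis_recurrence {a e d : ℕ → ℂ} (ha₀ : a 0 = 1) (he₀ : e 0 = 1)
    (hd₀ : d 0 = 1)
    (ha : ∀ n, (n + 1) * a (n + 1) = ∑ j ∈ Finset.range (n + 1), a (n - j) * ((j + 1) * e j))
    (hd : ∀ n, (n + 1) * d (n + 1) =
      ∑ j ∈ Finset.range (n + 1), d (n - j) * ((j + 1) * (e j - d j)))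
    (he : ∀ n, (n + 1) * e (n + 1) =
      ∑ j ∈ Finset.range (n + 1), e (n - j) * ((j + 1) * (a j + (e j - d j))))
    (n : ℕ) : (n + 1) * (a n + (e n - d n)) =
      (taylorPowerSeries fun u =>
        deriv misTree u * Complex.exp ((n + 1) * misExponent u)).coeff n := by
  have hga : AnalyticAt ℂ misExponent 0 :=
    Differentiable.analyticAt (by unfold misExponent; fun_prop) 0
  have hTa : AnalyticAt ℂ misTree 0 :=
    Differentiable.analyticAt (by unfold misTree misExponent; fun_prop) 0
  have hg0 : misExponent 0 = 0 := by simp [misExponent]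
  have hT0 : misTree 0 = 0 := by simp [misTree, misExponent]
  obtain ⟨D, hD, hD0, hl, hr⟩ := exists_analyticAt_inverse_mul_exp hga
  have hgD : AnalyticAt ℂ (fun x => misExponent (D x)) 0 :=
    AnalyticAt.fun_comp (by rwa [hD0]) hD
  have hTD : AnalyticAt ℂ (fun x => misTree (D x)) 0 :=
    AnalyticAt.fun_comp (by rwa [hD0]) hD
  set fa : ℂ → ℂ := fun x => Complex.exp (D x + misExponent (D x)) with hfa
  set fe : ℂ → ℂ := fun x => Complex.exp (misTree (D x)) with hfe
  set fd : ℂ → ℂ := fun x => Complex.exp (misExponent (D x)) with hfd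
  have haa : AnalyticAt ℂ fa 0 := (hD.add hgD).cexp
  have hea : AnalyticAt ℂ fe 0 := hTD.cexp
  have hda : AnalyticAt ℂ fd 0 := hgD.cexp
  have hxd : ∀ᶠ x in 𝓝 0, x * fd x = D x := hr
  have hxa : ∀ᶠ x in 𝓝 0, x * fa x = D x * Complex.exp (D x) := by
    filter_upwards [hr] with x hx
    simp only [hfa, Complex.exp_add]
    linear_combination Complex.exp (D x) * hx
  have hxe : ∀ᶠ x in 𝓝 0, x * fe x = D x + misExponent (D x) := by
    filter_upwards [hr] with x hx
    have h : D x + misExponent (D x) = D x * Complex.exp (D x * Complex.exp (D x)) := by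
      rw [misExponent]; ring
    simp only [h, hfe, misTree, Complex.exp_add]
    linear_combination Complex.exp (D x * Complex.exp (D x)) * hx
  have hxm : ∀ᶠ x in 𝓝 0, x * (fa + (fe - fd)) x = misTree (D x) := by
    filter_upwards [hxd, hxa, hxe] with x h₁ h₂ h₃
    rw [Pi.add_apply, Pi.sub_apply, mul_add, mul_sub, h₁, h₂, h₃, misTree]
    ring
  have hfa' : fa =ᶠ[𝓝 0] fun x => Complex.exp (x * fe x) := by
    filter_upwards [hxe] with x hx
    rw [hx]
  have hfd' : fd =ᶠ[𝓝 0] fun x => Complex.exp (x * (fe - fd) x) := by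
    filter_upwards [hxe, hxd] with x h₁ h₂
    rw [Pi.sub_apply, mul_sub, h₁, h₂, add_sub_cancel_left]
  have hfe' : fe =ᶠ[𝓝 0] fun x => Complex.exp (x * (fa + (fe - fd)) x) := by
    filter_upwards [hxm] with x hx
    rw [hx]
  have hc (n : ℕ) : (taylorPowerSeries fa).coeff n = a n ∧ (taylorPowerSeries fe).coeff n = e n ∧
      (taylorPowerSeries fd).coeff n = d n := by
    induction n using Nat.strong_induction_on with
    | _ n ih =>
      rcases n with _ | n
      · simp [taylorPowerSeries.coeff_zero, ha₀, he₀, hd₀, hfa, hfe, hfd, hD0, hg0, hT0,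
          -PowerSeries.coeff_zero_eq_constantCoeff]
      · have hb (j : ℕ) (hj : j ≤ n) : (taylorPowerSeries (fe - fd)).coeff j = e j - d j := by
          rw [taylorPowerSeries.sub hea hda, map_sub, (ih j (by omega)).2.1,
            (ih j (by omega)).2.2]
        refine ⟨?_, ?_, ?_⟩
        · exact taylorPowerSeries.coeff_exp_eq_of_recurrence hea hfa' (ha n)
            (fun j hj => (ih j (by omega)).1) fun j hj => (ih j (by omega)).2.1
        · refine taylorPowerSeries.coeff_exp_eq_of_recurrence (haa.add (hea.sub hda)) hfe'
            (q := fun j => a j + (e j - d j)) (he n)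
            (fun j hj => (ih j (by omega)).2.1) fun j hj => ?_
          rw [taylorPowerSeries.add haa (hea.sub hda), map_add, (ih j (by omega)).1, hb j hj]
        · exact taylorPowerSeries.coeff_exp_eq_of_recurrence (hea.sub hda) hfd'
            (q := fun j => e j - d j) (hd n) (fun j hj => (ih j (by omega)).2.2) hb
  have hma : AnalyticAt ℂ (fa + (fe - fd)) 0 := haa.add (hea.sub hda)
  have hfX : (fun u => (fun x => x * (fa + (fe - fd)) x) (u * Complex.exp (-misExponent u)))
      =ᶠ[𝓝 0] misTree := by
    have hXc : Tendsto (fun u : ℂ => u * Complex.exp (-misExponent u)) (𝓝 0) (𝓝 0) :=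
      (Continuous.tendsto' (by unfold misExponent; fun_prop) _ _ (by simp))
    filter_upwards [hl, hXc.eventually hxm] with u h₁ h₂
    rw [h₁] at h₂
    exact h₂
  rw [← taylorPowerSeries.succ_mul_coeff_of_comp hga (analyticAt_id.mul hma) hfX n]
  congr 1
  rw [← (hc n).1, ← (hc n).2.1, ← (hc n).2.2, ← map_sub, ← taylorPowerSeries.sub hea hda,
    ← map_add, ← taylorPowerSeries.add haa (hea.sub hda)]
  exact (taylorPowerSeries.coeff_succ_id_mul hma n).symm

open Real in
/-- **Laplace's method** for integrals over a period. -/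
lemma tendsto_sqrt_mul_integral_exp {ψ G : ℝ → ℂ} {b c : ℝ} (hc : 0 < c) (hG : Continuous G)
    (hψ : Continuous ψ) (hψ₀ : ψ 0 = 0)
    (hlim : Tendsto (fun θ : ℝ => ψ θ / θ ^ 2) (𝓝[≠] 0) (𝓝 (-b : ℂ)))
    (hbound : ∀ θ : ℝ, |θ| ≤ π → (ψ θ).re ≤ -c * θ ^ 2) :
    Tendsto (fun N : ℕ => (√(N + 1) : ℂ) * ∫ θ in -π..π, G θ * Complex.exp ((N + 1) * ψ θ))
      atTop (𝓝 (G 0 * √(π / b))) := by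
  set q : ℕ → ℝ := fun N => √(N + 1) with hq
  have hqpos (N : ℕ) : 0 < q N := by positivity
  have hqsq (N : ℕ) : q N ^ 2 = N + 1 := sq_sqrt (by positivity)
  have hqtop : Tendsto q atTop atTop :=
    tendsto_sqrt_atTop.comp (tendsto_atTop_add_const_right _ _ tendsto_natCast_atTop_atTop)
  obtain ⟨B, hB⟩ := (isCompact_Icc (a := -π) (b := π)).exists_bound_of_continuousOn
    hG.continuousOn
  set F : ℕ → ℝ → ℂ := fun N => (Set.Ioc (-(π * q N)) (π * q N)).indicator
    fun s => G (s / q N) * Complex.exp ((N + 1) * ψ (s / q N)) with hF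
  have hint (N : ℕ) : (√(N + 1) : ℂ) * ∫ θ in -π..π, G θ * Complex.exp ((N + 1) * ψ θ) =
      ∫ s, F N s := by
    have h := intervalIntegral.integral_comp_div (a := -(π * q N)) (b := π * q N)
      (fun θ => G θ * Complex.exp ((N + 1) * ψ θ)) (hqpos N).ne'
    rw [neg_div, mul_div_cancel_right₀ _ (hqpos N).ne'] at h
    rw [hF, integral_indicator measurableSet_Ioc, ← intervalIntegral.integral_of_le, h,
      Complex.real_smul]
    have := mul_pos pi_pos (hqpos N)
    linarith
  have habs {N : ℕ} {s : ℝ} (hs : s ∈ Set.Ioc (-(π * q N)) (π * q N)) : |s / q N| ≤ π := by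
    rw [abs_div, abs_of_pos (hqpos N), div_le_iff₀ (hqpos N), abs_le]
    exact ⟨hs.1.le, hs.2⟩
  simp_rw [hint]
  have hgauss : ∫ s : ℝ, G 0 * ((exp (-b * s ^ 2) : ℝ) : ℂ) = G 0 * √(π / b) := by
    rw [integral_const_mul, integral_complex_ofReal, integral_gaussian]
  rw [← hgauss]
  refine tendsto_integral_of_dominated_convergence (fun s => B * exp (-c * s ^ 2)) ?_
    ((integrable_exp_neg_mul_sq hc).const_mul B) ?_ ?_
  · exact fun N => (Continuous.aestronglyMeasurable (by fun_prop)).indicator measurableSet_Ioc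
  · refine fun N => Eventually.of_forall fun s => ?_
    by_cases hs : s ∈ Set.Ioc (-(π * q N)) (π * q N)
    · rw [hF]
      simp only [Set.indicator_of_mem hs, norm_mul, Complex.norm_exp]
      have h₁ := hB (s / q N) (abs_le.1 (habs hs))
      have h₂ : (((N : ℂ) + 1) * ψ (s / q N)).re = (N + 1) * (ψ (s / q N)).re := by
        rw [← Nat.cast_add_one, ← Complex.ofReal_natCast, Complex.re_ofReal_mul]
        push_cast; ring
      have h₃ : (N + 1) * (ψ (s / q N)).re ≤ -c * s ^ 2 := by
        calc (N + 1) * (ψ (s / q N)).re ≤ (N + 1) * (-c * (s / q N) ^ 2) := by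
              gcongr; exact hbound _ (habs hs)
          _ = -c * s ^ 2 := by
              rw [div_pow, hqsq]; field_simp
      rw [h₂]
      exact mul_le_mul h₁ (exp_le_exp.2 h₃) (exp_pos _).le ((norm_nonneg _).trans h₁)
    · rw [hF]
      simp only [Set.indicator_of_notMem hs, norm_zero]
      have := (norm_nonneg _).trans (hB 0 ⟨by linarith [pi_pos], pi_pos.le⟩)
      positivity
  · refine Eventually.of_forall fun s => ?_
    have hev : ∀ᶠ N in atTop, s ∈ Set.Ioc (-(π * q N)) (π * q N) := by
      filter_upwards [hqtop.eventually_gt_atTop |s|] with N hN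
      have h₁ : |s| < π * q N := hN.trans_le (by nlinarith [pi_gt_three, hqpos N])
      exact ⟨(abs_lt.1 h₁).1, (abs_lt.1 h₁).2.le⟩
    have hs0 : Tendsto (fun N => s / q N) atTop (𝓝 0) := hqtop.const_div_atTop s
    have hGl : Tendsto (fun N => G (s / q N)) atTop (𝓝 (G 0)) := (hG.tendsto 0).comp hs0
    have hψl : Tendsto (fun N : ℕ => ((N : ℂ) + 1) * ψ (s / q N)) atTop
        (𝓝 ((-b * s ^ 2 : ℝ) : ℂ)) := by
      rcases eq_or_ne s 0 with rfl | hs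
      · simp [hψ₀]
      · have h : Tendsto (fun N => s / q N) atTop (𝓝[≠] 0) :=
          tendsto_nhdsWithin_iff.2 ⟨hs0, Eventually.of_forall fun N =>
            div_ne_zero hs (hqpos N).ne'⟩
        have h' := (hlim.comp h).mul_const ((s : ℂ) ^ 2)
        push_cast
        refine h'.congr fun N => ?_
        have h₁ : (q N : ℂ) ^ 2 = N + 1 := by exact_mod_cast hqsq N
        have h₂ : (q N : ℂ) ≠ 0 := by exact_mod_cast (hqpos N).ne'
        have h₃ : (s : ℂ) ≠ 0 := by exact_mod_cast hs
        rw [← h₁, Function.comp_apply, Complex.ofReal_div]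
        field_simp
    rw [Complex.ofReal_exp]
    refine (hGl.mul hψl.cexp).congr' ?_
    filter_upwards [hev] with N hN
    rw [hF]
    simp only [Set.indicator_of_mem hN]

namespace taylorPowerSeries

open Real in
/-- Cauchy's formula for the Taylor coefficients, as an integral over an angle. -/
lemma coeff_eq_integral {f : ℂ → ℂ} (hf : Differentiable ℂ f) {τ : ℝ} (hτ : 0 < τ) (n : ℕ) :
    (taylorPowerSeries f).coeff n =
      (2 * π)⁻¹ * ∫ θ in -π..π, f (circleMap 0 τ θ) / circleMap 0 τ θ ^ n := by
  have h := hf.differentiableOn.circleIntegral_one_div_sub_center_pow_smul (c := 0) hτ n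
  have hper : Function.Periodic (fun θ => f (circleMap 0 τ θ) / circleMap 0 τ θ ^ n) (2 * π) :=
    fun θ => by simp only [periodic_circleMap 0 τ θ]
  have hshift := hper.intervalIntegral_add_eq 0 (-π)
  rw [zero_add, show -π + 2 * π = π by ring] at hshift
  rw [← hshift, coeff_eq]
  have hI : (∮ z in C(0, τ), (1 / (z - 0) ^ (n + 1)) • f z) =
      Complex.I * ∫ θ in 0..2 * π, f (circleMap 0 τ θ) / circleMap 0 τ θ ^ n := by
    rw [circleIntegral, ← intervalIntegral.integral_const_mul]
    refine intervalIntegral.integral_congr fun θ _ => ?_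
    have := circleMap_ne_center hτ.ne' (c := 0) (θ := θ)
    simp only [deriv_circleMap, smul_eq_mul, sub_zero, pow_succ]
    field_simp
  rw [hI, smul_eq_mul] at h
  have hn : (n.factorial : ℂ) ≠ 0 := Nat.cast_ne_zero.2 n.factorial_ne_zero
  have hπ : (π : ℂ) ≠ 0 := Complex.ofReal_ne_zero.2 pi_ne_zero
  have h' : ∫ θ in 0..2 * π, f (circleMap 0 τ θ) / circleMap 0 τ θ ^ n =
      (2 * π / n.factorial) * iteratedDeriv n f 0 := by
    apply mul_left_cancel₀ Complex.I_ne_zero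
    rw [h]; ring
  rw [h']
  push_cast
  field_simp

end taylorPowerSeries

open scoped ComplexOrder in
/-- An entire function all of whose Taylor coefficients at the origin are nonnegative reals. -/
structure NonnegTaylor (f : ℂ → ℂ) : Prop where
  differentiable : Differentiable ℂ f
  coeff_nonneg : ∀ n, 0 ≤ (taylorPowerSeries f).coeff n

namespace NonnegTaylor

variable {f g : ℂ → ℂ}

open scoped ComplexOrder

lemma add (hf : NonnegTaylor f) (hg : NonnegTaylor g) : NonnegTaylor (fun z => f z + g z) where
  differentiable := hf.differentiable.fun_add hg.differentiable
  coeff_nonneg n := by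
    rw [show (fun z => f z + g z) = f + g from rfl, taylorPowerSeries.add
      (hf.differentiable.analyticAt 0) (hg.differentiable.analyticAt 0), map_add]
    exact add_nonneg (hf.coeff_nonneg n) (hg.coeff_nonneg n)

lemma const {c : ℂ} (hc : 0 ≤ c) : NonnegTaylor (fun _ => c) where
  differentiable := by fun_prop
  coeff_nonneg n := by
    rw [taylorPowerSeries.const_eq, PowerSeries.coeff_C]
    split_ifs
    exacts [hc, le_rfl]

lemma id_mul (hf : NonnegTaylor f) : NonnegTaylor (fun z => z * f z) where
  differentiable := differentiable_id.fun_mul hf.differentiable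
  coeff_nonneg n := by
    rcases n with _ | n
    · simp [taylorPowerSeries.coeff_zero, -PowerSeries.coeff_zero_eq_constantCoeff]
    · rw [taylorPowerSeries.coeff_succ_id_mul (hf.differentiable.analyticAt 0)]
      exact hf.coeff_nonneg n

lemma exp_id_mul (hf : NonnegTaylor f) : NonnegTaylor (fun z => Complex.exp (z * f z)) where
  differentiable := (differentiable_id.fun_mul hf.differentiable).cexp
  coeff_nonneg n := by
    induction n using Nat.strong_induction_on with
    | _ n ih =>
      rcases n with _ | n
      · simp [taylorPowerSeries.coeff_zero, -PowerSeries.coeff_zero_eq_constantCoeff]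
      · have h := taylorPowerSeries.succ_mul_coeff_exp (hf.differentiable.analyticAt 0)
          (EventuallyEq.refl _ _) n
        have hn : (0 : ℂ) ≤ (((n : ℝ) + 1)⁻¹ : ℝ) := Complex.zero_le_real.2 (by positivity)
        rw [← inv_mul_cancel_left₀ (Nat.cast_add_one_ne_zero (R := ℂ) n)
          (PowerSeries.coeff (n + 1) _), h]
        refine mul_nonneg (by simpa using hn) ?_
        refine Finset.sum_nonneg fun j _ => mul_nonneg (ih _ (by omega))
          (mul_nonneg ?_ (hf.coeff_nonneg j))
        exact_mod_cast j.succ.cast_nonneg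

lemma deriv (hf : NonnegTaylor f) : NonnegTaylor (deriv f) where
  differentiable z := (hf.differentiable.analyticAt z).deriv.differentiableAt
  coeff_nonneg n := by
    rw [taylorPowerSeries.deriv_eq, PowerSeries.coeff_derivative]
    refine mul_nonneg (hf.coeff_nonneg _) ?_
    exact_mod_cast n.succ.cast_nonneg

lemma hasSum (hf : NonnegTaylor f) (z : ℂ) :
    HasSum (fun n => (taylorPowerSeries f).coeff n * z ^ n) (f z) := by
  have h : (fun n => (taylorPowerSeries f).coeff n * z ^ n) =
      fun n => (n.factorial : ℂ)⁻¹ • (z - 0) ^ n • iteratedDeriv n f 0 := by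
    ext n
    rw [taylorPowerSeries.coeff_eq, sub_zero, smul_eq_mul, smul_eq_mul]
    ring
  rw [h]
  exact Complex.hasSum_taylorSeries_of_entire hf.differentiable 0 z

lemma coeff_eq_re (hf : NonnegTaylor f) (n : ℕ) : (taylorPowerSeries f).coeff n =
    (((taylorPowerSeries f).coeff n).re : ℂ) :=
  Complex.eq_re_of_ofReal_le (r := 0) (by simpa using hf.coeff_nonneg n)

lemma coeff_zero_le (hf : NonnegTaylor f) {τ : ℝ} (hτ : 0 ≤ τ) : f 0 ≤ f τ := by
  have h := hf.hasSum τ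
  refine (le_hasSum h 0 fun n _ => mul_nonneg (hf.coeff_nonneg n) ?_).trans' ?_
  · exact_mod_cast pow_nonneg hτ n
  · rw [taylorPowerSeries.coeff_zero, pow_zero, mul_one]

lemma apply_nonneg (hf : NonnegTaylor f) {τ : ℝ} (hτ : 0 ≤ τ) : 0 ≤ f τ :=
  (hf.coeff_zero_le hτ).trans' (by
    simpa only [taylorPowerSeries.coeff_zero] using hf.coeff_nonneg 0)

lemma sum_coeff_le_re_sub_re (hf : NonnegTaylor f) {τ : ℝ} (hτ : 0 ≤ τ) (θ : ℝ) (s : Finset ℕ) :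
    ∑ k ∈ s, ((taylorPowerSeries f).coeff k).re * τ ^ k * (1 - Real.cos (k * θ)) ≤
      (f τ).re - (f (circleMap 0 τ θ)).re := by
  have h := Complex.hasSum_re ((hf.hasSum τ).sub (hf.hasSum (circleMap 0 τ θ)))
  rw [Complex.sub_re] at h
  have hterm (k : ℕ) : ((taylorPowerSeries f).coeff k * (τ : ℂ) ^ k -
      (taylorPowerSeries f).coeff k * circleMap 0 τ θ ^ k).re =
      ((taylorPowerSeries f).coeff k).re * τ ^ k * (1 - Real.cos (k * θ)) := by
    rw [hf.coeff_eq_re k, circleMap_zero, mul_pow, ← Complex.exp_nat_mul, ← mul_assoc,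
      show (k : ℂ) * (θ * Complex.I) = ((k * θ : ℝ) : ℂ) * Complex.I by push_cast; ring,
      ← Complex.ofReal_pow, ← Complex.ofReal_mul, Complex.sub_re, Complex.re_ofReal_mul,
      Complex.exp_ofReal_mul_I_re, Complex.ofReal_re, Complex.ofReal_re]
    ring
  simp_rw [hterm] at h
  refine sum_le_hasSum s (fun k _ => ?_) h
  have h₁ : 0 ≤ ((taylorPowerSeries f).coeff k).re := (Complex.nonneg_iff.1 (hf.coeff_nonneg k)).1
  have h₂ := Real.cos_le_one (k * θ)
  have h₃ : 0 ≤ 1 - Real.cos (k * θ) := by linarith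
  positivity

end NonnegTaylor

lemma AnalyticAt.tendsto_div_sq {f : ℂ → ℂ} (hf : AnalyticAt ℂ f 0) (hf₀ : f 0 = 0)
    (hf₁ : deriv f 0 = 0) :
    Tendsto (fun z => f z / z ^ 2) (𝓝[≠] 0) (𝓝 (deriv (deriv f) 0 / 2)) := by
  have hslope {h : ℂ → ℂ} (hh : AnalyticAt ℂ h 0) : AnalyticAt ℂ (dslope h 0) 0 := by
    obtain ⟨p, hp⟩ := hh
    exact hp.has_fpower_series_dslope_fslope.analyticAt
  have hmul {h : ℂ → ℂ} (hh : h 0 = 0) : h = fun z => z * dslope h 0 z := by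
    ext z
    simpa [hh] using (sub_smul_dslope h 0 z).symm
  have h₁ := hslope hf
  have h₂ := hslope h₁
  have h0 : dslope f 0 0 = 0 := by rw [dslope_same, hf₁]
  have hval : dslope (dslope f 0) 0 0 = deriv (deriv f) 0 / 2 := by
    rw [← taylorPowerSeries.coeff_zero (dslope (dslope f 0) 0),
      ← taylorPowerSeries.coeff_succ_id_mul h₂, ← hmul h0,
      ← taylorPowerSeries.coeff_succ_id_mul h₁, ← hmul hf₀, taylorPowerSeries.coeff_eq,
      iteratedDeriv_succ, iteratedDeriv_one]
    simp
  rw [← hval]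
  refine (h₂.continuousAt.tendsto.mono_left nhdsWithin_le_nhds).congr' ?_
  filter_upwards [self_mem_nhdsWithin] with z hz
  have hz : z ≠ 0 := hz
  rw [congrFun (hmul hf₀) z, congrFun (hmul h0) z]
  field_simp

open Real in
lemma tendsto_phase_div_sq {g : ℂ → ℂ} (hg : Differentiable ℂ g) {τ : ℝ}
    (hτ : τ * deriv g τ = 1) :
    Tendsto (fun θ : ℝ => (g (circleMap 0 τ θ) - g τ - θ * Complex.I) / θ ^ 2) (𝓝[≠] 0)
      (𝓝 (-((1 + τ ^ 2 * deriv (deriv g) τ) / 2))) := by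
  set Ψ : ℂ → ℂ := fun z => g (τ * Complex.exp (z * Complex.I)) - g τ - z * Complex.I with hΨ
  have hcurve (z : ℂ) : HasDerivAt (fun z : ℂ => τ * Complex.exp (z * Complex.I))
      (τ * (Complex.exp (z * Complex.I) * Complex.I)) z := by
    have := ((hasDerivAt_id' z).mul_const Complex.I).cexp.const_mul (τ : ℂ)
    simpa using this
  have hd : deriv Ψ = fun z => deriv g (τ * Complex.exp (z * Complex.I)) *
      (τ * (Complex.exp (z * Complex.I) * Complex.I)) - Complex.I := by
    ext z
    have h := (hg (τ * Complex.exp (z * Complex.I))).hasDerivAt.comp z (hcurve z)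
    have h' := (h.sub_const (g τ)).sub ((hasDerivAt_id' z).mul_const Complex.I)
    rw [one_mul] at h'
    exact h'.deriv
  have hdd : deriv (deriv Ψ) 0 = -(1 + τ ^ 2 * deriv (deriv g) τ) := by
    have hg' : HasDerivAt (deriv g) (deriv (deriv g) τ) (τ * Complex.exp (0 * Complex.I)) := by
      simpa using ((hg.analyticAt τ).deriv.differentiableAt).hasDerivAt
    have h₁ := hg'.comp 0 (hcurve 0)
    have h₂ := (((hasDerivAt_id' (0 : ℂ)).mul_const Complex.I).cexp.mul_const
      Complex.I).const_mul (τ : ℂ)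
    have h := (h₁.fun_mul h₂).sub_const Complex.I
    rw [hd]
    refine h.deriv.trans ?_
    simp only [Function.comp_apply, zero_mul, Complex.exp_zero, mul_one, one_mul]
    linear_combination (-1 : ℂ) * hτ + (τ * τ * deriv (deriv g) τ + τ * deriv g τ) * Complex.I_sq
  have hΨa : AnalyticAt ℂ Ψ 0 := Differentiable.analyticAt (by fun_prop) 0
  have h := hΨa.tendsto_div_sq (by simp [hΨ]) (by
    rw [hd]
    simp only [zero_mul, Complex.exp_zero, mul_one, one_mul]
    linear_combination Complex.I * hτ)
  rw [hdd, neg_div] at h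
  have hofReal : Tendsto (fun θ : ℝ => (θ : ℂ)) (𝓝[≠] 0) (𝓝[≠] 0) :=
    tendsto_nhdsWithin_iff.2 ⟨(Complex.continuous_ofReal.tendsto' 0 0 rfl).mono_left
      nhdsWithin_le_nhds, by
        filter_upwards [self_mem_nhdsWithin] with θ hθ
        exact Complex.ofReal_ne_zero.2 hθ⟩
  refine (h.comp hofReal).congr fun θ => ?_
  rw [Function.comp_apply, hΨ, circleMap_zero]

open Real in
/-- **Saddle point asymptotics** for the coefficients produced by Lagrange inversion. -/
lemma NonnegTaylor.exists_tendsto_of_saddle {g F : ℂ → ℂ} (hg : NonnegTaylor g)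
    (hF : NonnegTaylor F) (hF₀ : F 0 ≠ 0) {τ c : ℝ} (hτ : 0 < τ)
    (hsaddle : τ * _root_.deriv g τ = 1) (hc : 0 < c)
    (hgap : ∀ θ : ℝ, |θ| ≤ π → c * θ ^ 2 ≤ (g τ).re - (g (circleMap 0 τ θ)).re)
    {v : ℕ → ℝ} (hv : ∀ n : ℕ, ((n : ℂ) + 1) * v n =
      (taylorPowerSeries fun u => F u * Complex.exp ((n + 1) * g u)).coeff n) :
    ∃ K > 0, Tendsto (fun n : ℕ => v n * (τ * exp (-(g τ).re)) ^ (n + 1) *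
      ((n + 1) * √(n + 1))) atTop (𝓝 K) := by
  have hgd := hg.differentiable
  have hFd := hF.differentiable
  have hgτ : g τ = ((g τ).re : ℂ) :=
    Complex.eq_re_of_ofReal_le (r := 0) (by simpa using hg.apply_nonneg hτ.le)
  have hFτ : F τ = ((F τ).re : ℂ) :=
    Complex.eq_re_of_ofReal_le (r := 0) (by simpa using hF.apply_nonneg hτ.le)
  have hg''τ := hg.deriv.deriv.apply_nonneg hτ.le
  have hg''eq : _root_.deriv (_root_.deriv g) τ = ((_root_.deriv (_root_.deriv g) τ).re : ℂ) :=
    Complex.eq_re_of_ofReal_le (r := 0) (by simpa using hg''τ)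
  have hg''nonneg : 0 ≤ (_root_.deriv (_root_.deriv g) τ).re := (Complex.nonneg_iff.1 hg''τ).1
  set b : ℝ := (1 + τ ^ 2 * (_root_.deriv (_root_.deriv g) τ).re) / 2 with hb
  have hbpos : 0 < b := by positivity
  have hFpos : 0 < (F τ).re := by
    have h₁ := (Complex.nonneg_iff.1 (hF.apply_nonneg (τ := 0) le_rfl))
    have h₂ := (Complex.le_def.1 (hF.coeff_zero_le hτ.le)).1
    refine lt_of_lt_of_le (lt_of_le_of_ne (by simpa using h₁.1) fun h => hF₀ ?_) h₂
    exact Complex.ext h.symm (by simpa using h₁.2.symm)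
  set ψ : ℝ → ℂ := fun θ => g (circleMap 0 τ θ) - g τ - θ * Complex.I with hψ
  set G : ℝ → ℂ := fun θ => F (circleMap 0 τ θ) * Complex.exp (θ * Complex.I) with hG
  have hcm : Continuous (circleMap 0 τ) := continuous_circleMap 0 τ
  have hgc := hgd.continuous
  have hFc := hFd.continuous
  have hlim := tendsto_sqrt_mul_integral_exp (ψ := ψ) (G := G) (b := b) hc (by fun_prop)
    (by fun_prop) (by simp [hψ, circleMap_zero])
    (by
      have h := tendsto_phase_div_sq hgd hsaddle
      rw [hg''eq] at h
      convert h using 2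
      rw [hb]; push_cast; ring)
    (fun θ hθ => by
      have h := hgap θ hθ
      have h₂ : (ψ θ).re = (g (circleMap 0 τ θ)).re - (g τ).re := by simp [hψ]
      rw [h₂]; linarith)
  have hcoeff (n : ℕ) : ((n : ℂ) + 1) * v n * (τ * exp (-(g τ).re) : ℝ) ^ (n + 1) =
      τ * (2 * π : ℝ)⁻¹ * ∫ θ in -π..π, G θ * Complex.exp ((n + 1) * ψ θ) := by
    rw [hv, taylorPowerSeries.coeff_eq_integral (by fun_prop) hτ, mul_right_comm, mul_comm (τ : ℂ),
      mul_assoc _ (τ : ℂ), mul_assoc, Complex.ofReal_inv]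
    congr 1
    rw [← intervalIntegral.integral_const_mul, ← intervalIntegral.integral_const_mul]
    refine intervalIntegral.integral_congr fun θ _ => ?_
    have hτ' : (τ : ℂ) ≠ 0 := Complex.ofReal_ne_zero.2 hτ.ne'
    have h₁ : Complex.exp ((n + 1) * ψ θ) = Complex.exp ((n + 1) * g (circleMap 0 τ θ)) *
        (Complex.exp (-g τ) ^ (n + 1) * Complex.exp (-(θ * Complex.I)) ^ (n + 1)) := by
      rw [← Complex.exp_nat_mul, ← Complex.exp_nat_mul, ← Complex.exp_add, ← Complex.exp_add, hψ]
      push_cast; ring_nf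
    have h₂ : ((τ * exp (-(g τ).re) : ℝ) : ℂ) = τ * Complex.exp (-g τ) := by
      rw [hgτ]; push_cast; simp
    have h₃ : circleMap 0 τ θ ^ n = τ ^ n * Complex.exp (θ * Complex.I) ^ n := by
      rw [circleMap_zero, mul_pow]
    have h₄ := Complex.exp_ne_zero (θ * Complex.I)
    rw [h₁, h₂, h₃, hG, Complex.exp_neg (θ * Complex.I), mul_pow, inv_pow]
    simp only
    field_simp
    ring
  refine ⟨τ * (2 * π)⁻¹ * ((F τ).re * √(π / b)), by positivity, ?_⟩
  have h := hlim.const_mul ((τ * (2 * π)⁻¹ : ℝ) : ℂ)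
  have hG₀ : G 0 = ((F τ).re : ℂ) := by simp [hG, circleMap_zero, ← hFτ]
  rw [hG₀] at h
  have h' := (Complex.continuous_re.tendsto _).comp h
  convert h' using 2 with n
  · rw [Function.comp_apply]
    have h₁ : ((τ * (2 * π)⁻¹ : ℝ) : ℂ) * ((√((n : ℝ) + 1) : ℂ) *
        ∫ θ in -π..π, G θ * Complex.exp ((n + 1) * ψ θ)) =
        (√((n : ℝ) + 1) : ℂ) * (τ * (2 * π : ℝ)⁻¹ *
          ∫ θ in -π..π, G θ * Complex.exp ((n + 1) * ψ θ)) := by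
      push_cast; ring
    rw [h₁, ← hcoeff]
    norm_cast
    ring
  · norm_cast

namespace taylorPowerSeries

lemma coeff_succ_exp_id_mul_exp_sub_one (n : ℕ) :
    (taylorPowerSeries fun z => Complex.exp (z * Complex.exp z) - 1).coeff (n + 1) =
      (taylorPowerSeries fun z => Complex.exp (z * Complex.exp z)).coeff (n + 1) := by
  rw [show (fun z => Complex.exp (z * Complex.exp z) - 1) =
    (fun z => Complex.exp (z * Complex.exp z)) - fun _ => 1 from rfl,
    sub (Differentiable.analyticAt (by fun_prop) 0) (Differentiable.analyticAt (by fun_prop) 0),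
    map_sub, const_eq, PowerSeries.coeff_C, if_neg n.succ_ne_zero, sub_zero]

lemma succ_mul_coeff_exp_id_mul_exp (n : ℕ) :
    (n + 1) * (taylorPowerSeries fun z => Complex.exp (z * Complex.exp z)).coeff (n + 1) =
      ∑ j ∈ Finset.range (n + 1),
        (taylorPowerSeries fun z => Complex.exp (z * Complex.exp z)).coeff (n - j) *
          ((j + 1) * (taylorPowerSeries Complex.exp).coeff j) :=
  succ_mul_coeff_exp (Differentiable.analyticAt (by fun_prop) 0) (EventuallyEq.refl _ _) n

lemma coeff_one_exp_id_mul_exp :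
    (taylorPowerSeries fun z => Complex.exp (z * Complex.exp z)).coeff 1 = 1 := by
  simpa [coeff_zero, -PowerSeries.coeff_zero_eq_constantCoeff] using
    succ_mul_coeff_exp_id_mul_exp 0

lemma coeff_two_misExponent : (taylorPowerSeries misExponent).coeff 2 = 1 := by
  refine (coeff_succ_id_mul (Differentiable.analyticAt (by fun_prop) 0) 1).trans ?_
  rw [coeff_succ_exp_id_mul_exp_sub_one, coeff_one_exp_id_mul_exp]

lemma coeff_three_misExponent : (taylorPowerSeries misExponent).coeff 3 = 3 / 2 := by
  refine (coeff_succ_id_mul (Differentiable.analyticAt (by fun_prop) 0) 2).trans ?_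
  have hexp : (taylorPowerSeries Complex.exp).coeff 1 = 1 := by
    rw [coeff_eq, iteratedDeriv_one]
    simp
  have h := succ_mul_coeff_exp_id_mul_exp 1
  rw [Finset.sum_range_succ, Finset.sum_range_one, Nat.sub_zero, Nat.sub_self,
    coeff_one_exp_id_mul_exp, hexp, coeff_zero, coeff_zero] at h
  rw [coeff_succ_exp_id_mul_exp_sub_one]
  norm_num at h ⊢
  linear_combination h / 2

end taylorPowerSeries

open Real in
open scoped ComplexOrder in
/-- The exponential growth and the power of the number of rooted labelled trees. -/
lemma exists_tendsto_of_tree_recurrence {o : ℕ → ℝ} (h₀ : o 0 = 1)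
    (ho : ∀ n : ℕ, (n + 1) * o (n + 1) =
      ∑ j ∈ Finset.range (n + 1), o (n - j) * ((j + 1) * o j)) :
    ∃ K > 0, Tendsto (fun n : ℕ => o n * exp (-1) ^ (n + 1) * ((n + 1) * √(n + 1)))
      atTop (𝓝 K) := by
  have hid : NonnegTaylor fun u => u := by
    simpa using (NonnegTaylor.const zero_le_one).id_mul
  have h := hid.exists_tendsto_of_saddle (F := fun _ => 1) (τ := 1) (c := 2 / π ^ 2) (v := o)
    (NonnegTaylor.const zero_le_one) one_ne_zero one_pos (by simp) (by positivity)
    (fun θ hθ => by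
      have := cos_le_one_sub_mul_cos_sq hθ
      simp only [circleMap_zero, Complex.ofReal_one, one_mul, Complex.one_re,
        Complex.exp_ofReal_mul_I_re]
      linarith)
    (fun n => by
      have := succ_mul_eq_coeff_of_tree_recurrence (o := fun n => (o n : ℂ)) (by simp [h₀])
        (fun n => by exact_mod_cast ho n) n
      simpa using this)
  simpa using h

namespace NonnegTaylor

open scoped ComplexOrder

lemma exp_id_mul_exp : NonnegTaylor fun z => Complex.exp (z * Complex.exp z) := by
  simpa using (NonnegTaylor.const zero_le_one).exp_id_mul.exp_id_mul

lemma exp_id_mul_exp_sub_one : NonnegTaylor fun z => Complex.exp (z * Complex.exp z) - 1 where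
  differentiable := exp_id_mul_exp.differentiable.sub_const 1
  coeff_nonneg n := by
    rcases n with _ | n
    · simp [taylorPowerSeries.coeff_zero, -PowerSeries.coeff_zero_eq_constantCoeff]
    · rw [taylorPowerSeries.coeff_succ_exp_id_mul_exp_sub_one]
      exact exp_id_mul_exp.coeff_nonneg _

lemma misExponent : NonnegTaylor misExponent := exp_id_mul_exp_sub_one.id_mul

lemma misTree : NonnegTaylor misTree := by
  have : NonnegTaylor fun z => z * Complex.exp z := by
    simpa using (NonnegTaylor.const zero_le_one).exp_id_mul.id_mul
  exact this.add misExponent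

end NonnegTaylor

open Real in
lemma misExponent_ofReal (t : ℝ) : misExponent t = (t * (exp (t * exp t) - 1) : ℝ) := by
  simp [misExponent]

open Real in
lemma exists_saddle_misExponent : ∃ τ : ℝ, 0 < τ ∧ τ ≤ 1 ∧ τ * deriv misExponent τ = 1 := by
  set r : ℝ → ℝ := fun t =>
    t * (exp (t * exp t) - 1 + t * (exp (t * exp t) * (exp t + t * exp t))) with hr
  have hderiv (t : ℝ) : t * deriv misExponent t = (r t : ℂ) := by
    have h := (hasDerivAt_id' (t : ℂ)).fun_mul
      (((hasDerivAt_id' (t : ℂ)).fun_mul (Complex.hasDerivAt_exp t)).cexp.sub_const 1)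
    rw [show deriv misExponent t = _ from h.deriv, hr]
    push_cast
    ring
  have hmem : (1 : ℝ) ∈ Set.Icc (r 0) (r 1) := by
    have h₁ := add_one_le_exp (1 : ℝ)
    have h₂ := add_one_le_exp (exp 1)
    refine ⟨by simp [hr], ?_⟩
    simp only [hr, one_mul]
    nlinarith
  obtain ⟨τ, ⟨hτ₀, hτ₁⟩, hτ⟩ := intermediate_value_Icc zero_le_one
    (f := r) (by fun_prop) hmem
  refine ⟨τ, lt_of_le_of_ne hτ₀ ?_, hτ₁, by rw [hderiv, hτ, Complex.ofReal_one]⟩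
  rintro rfl
  simp [hr] at hτ

open Real in
lemma mul_sq_le_re_misExponent_sub {τ θ : ℝ} (hτ₀ : 0 < τ) (hτ₁ : τ ≤ 1) (hθ : |θ| ≤ π) :
    τ ^ 3 * (3 / (2 * π ^ 2)) * θ ^ 2 ≤
      (misExponent τ).re - (misExponent (circleMap 0 τ θ)).re := by
  have h := NonnegTaylor.misExponent.sum_coeff_le_re_sub_re hτ₀.le θ {2, 3}
  rw [Finset.sum_pair (by norm_num), taylorPowerSeries.coeff_two_misExponent,
    taylorPowerSeries.coeff_three_misExponent] at h
  refine le_trans ?_ h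
  have hcos := cos_le_one_sub_mul_cos_sq hθ
  push_cast
  rw [cos_two_mul, cos_three_mul]
  have hx₁ := cos_le_one θ
  have hx₂ := neg_one_le_cos θ
  set x := cos θ
  have hc : 3 / (2 * π ^ 2) * θ ^ 2 ≤ 3 / 4 * (1 - x) := by
    rw [show 3 / (2 * π ^ 2) * θ ^ 2 = 3 / 4 * (2 / π ^ 2 * θ ^ 2) by ring]
    linarith
  have hq : 3 / 4 * (1 - x) ≤ (1 - (2 * x ^ 2 - 1)) + (1 - (4 * x ^ 3 - 3 * x)) := by
    nlinarith [mul_nonneg (sub_nonneg.2 hx₁) (sq_nonneg (2 * x + 3 / 2))]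
  have hτ : τ ^ 3 ≤ τ ^ 2 := pow_le_pow_of_le_one hτ₀.le hτ₁ (by norm_num)
  have h₂ : 0 ≤ 1 - (2 * x ^ 2 - 1) := by nlinarith
  have h₃ : 0 ≤ 1 - (4 * x ^ 3 - 3 * x) := by
    nlinarith [mul_nonneg (sub_nonneg.2 hx₁) (sq_nonneg (2 * x + 1))]
  have h₄ : 0 ≤ τ ^ 3 := by positivity
  have e₂ := mul_le_mul_of_nonneg_right hτ h₂
  have e₃ := mul_nonneg h₄ h₃
  have e₄ := mul_le_mul_of_nonneg_left (hc.trans hq) h₄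
  have : (3 / 2 : ℂ).re = 3 / 2 := by norm_num
  rw [this, Complex.one_re]
  nlinarith

open Real in
lemma mul_exp_neg_misExponent_lt {t : ℝ} (ht : 0 < t) :
    t * exp (-(misExponent t).re) < exp (-1) := by
  rw [misExponent_ofReal, Complex.ofReal_re, ← exp_log ht, ← exp_add, exp_lt_exp, exp_log ht]
  have h₁ : t * (t * (1 + t)) ≤ t * (exp (t * exp t) - 1) := by
    refine mul_le_mul_of_nonneg_left ?_ ht.le
    have := add_one_le_exp (t * exp t)
    have := mul_le_mul_of_nonneg_left (add_one_le_exp t) ht.le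
    linarith
  have h₂ : log t ≤ -log 2 + (2 * t - 1) := by
    have := log_le_sub_one_of_pos (x := 2 * t) (by positivity)
    rw [log_mul two_ne_zero ht.ne'] at this
    linarith
  have h₃ := log_two_gt_d9
  nlinarith [sq_nonneg (t - 0.55), mul_nonneg ht.le (sq_nonneg (t - 0.55))]

open Real in
/-- The exponential growth and the power of the number of rooted labelled trees with a maximal
independent set. -/
lemma exists_tendsto_of_mis_recurrence {a e d : ℕ → ℝ} (ha₀ : a 0 = 1) (he₀ : e 0 = 1)
    (hd₀ : d 0 = 1)
    (ha : ∀ n : ℕ, (n + 1) * a (n + 1) =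
      ∑ j ∈ Finset.range (n + 1), a (n - j) * ((j + 1) * e j))
    (hd : ∀ n : ℕ, (n + 1) * d (n + 1) =
      ∑ j ∈ Finset.range (n + 1), d (n - j) * ((j + 1) * (e j - d j)))
    (he : ∀ n : ℕ, (n + 1) * e (n + 1) =
      ∑ j ∈ Finset.range (n + 1), e (n - j) * ((j + 1) * (a j + (e j - d j)))) :
    ∃ ρ : ℝ, 0 < ρ ∧ ρ < exp (-1) ∧ ∃ K > 0, Tendsto (fun n : ℕ =>
      (a n + (e n - d n)) * ρ ^ (n + 1) * ((n + 1) * √(n + 1))) atTop (𝓝 K) := by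
  obtain ⟨τ, hτ₀, hτ₁, hτ⟩ := exists_saddle_misExponent
  refine ⟨τ * exp (-(misExponent τ).re), by positivity, mul_exp_neg_misExponent_lt hτ₀, ?_⟩
  refine NonnegTaylor.misExponent.exists_tendsto_of_saddle (F := deriv misTree)
    (c := τ ^ 3 * (3 / (2 * π ^ 2))) NonnegTaylor.misTree.deriv ?_ hτ₀ hτ (by positivity)
    (fun θ hθ => mul_sq_le_re_misExponent_sub hτ₀ hτ₁ hθ) fun n => ?_
  · have h := ((hasDerivAt_id' (0 : ℂ)).fun_mul (Complex.hasDerivAt_exp 0)).add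
      ((hasDerivAt_id' (0 : ℂ)).fun_mul (((hasDerivAt_id' (0 : ℂ)).fun_mul
        (Complex.hasDerivAt_exp 0)).cexp.sub_const 1))
    rw [show deriv misTree 0 = _ from h.deriv]
    simp
  · have := succ_mul_eq_coeff_of_mis_recurrence (a := fun n => (a n : ℂ))
      (e := fun n => (e n : ℂ)) (d := fun n => (d n : ℂ)) (by simp [ha₀]) (by simp [he₀])
      (by simp [hd₀]) (fun n => by exact_mod_cast ha n) (fun n => by exact_mod_cast hd n)
      (fun n => by exact_mod_cast he n) n
    simpa using this

/-! ### From connected structures to sets of them -/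

lemma tendsto_const_div_natCast_add_one (c : ℝ) :
    Tendsto (fun n : ℕ => c / ((n : ℝ) + 1)) atTop (𝓝 0) := by
  exact_mod_cast (tendsto_add_atTop_iff_nat 1).2 (tendsto_const_div_atTop_nhds_zero_nat c)

section ExpRecurrence

variable {v h w : ℕ → ℝ} {B K : ℝ}

lemma nonneg_of_exp_recurrence (hv : ∀ n, 0 ≤ v n) (h₀ : h 0 = 1)
    (hh : ∀ n : ℕ, (n + 1) * h (n + 1) = ∑ j ∈ Finset.range (n + 1), h (n - j) * v j) (n : ℕ) :
    0 ≤ h n := by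
  induction n using Nat.strong_induction_on with
  | _ n ih =>
    rcases n with _ | n
    · simp [h₀]
    · have : 0 ≤ ((n : ℝ) + 1) * h (n + 1) := by
        rw [hh]
        exact Finset.sum_nonneg fun j _ => mul_nonneg (ih _ (by omega)) (hv j)
      exact nonneg_of_mul_nonneg_right this (by positivity)

lemma sum_le_exp_of_exp_recurrence (hv : ∀ n, 0 ≤ v n) (h₀ : h 0 = 1)
    (hh : ∀ n : ℕ, (n + 1) * h (n + 1) = ∑ j ∈ Finset.range (n + 1), h (n - j) * v j)
    {V : ℝ} (hV : ∀ n, ∑ j ∈ Finset.range n, v j ≤ V) (N : ℕ) :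
    ∑ n ∈ Finset.range (N + 1), h n ≤ Real.exp V := by
  have hpos := nonneg_of_exp_recurrence hv h₀ hh
  set P : ℝ → ℝ := fun x => ∑ n ∈ Finset.range (N + 1), h n * x ^ n with hP
  have hderiv (x : ℝ) : HasDerivAt P (∑ n ∈ Finset.range N,
      (∑ j ∈ Finset.range (n + 1), h (n - j) * v j) * x ^ n) x := by
    have := HasDerivAt.fun_sum (u := Finset.range (N + 1))
      fun n _ => (hasDerivAt_pow n x).const_mul (h n)
    rw [Finset.sum_range_succ'] at this
    refine this.congr_deriv ?_
    rw [Nat.cast_zero, zero_mul, mul_zero, add_zero]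
    refine Finset.sum_congr rfl fun n _ => ?_
    rw [← hh, Nat.add_sub_cancel]
    push_cast
    ring
  have hle {x : ℝ} (hx : x ∈ Set.Icc (0 : ℝ) 1) : ∑ n ∈ Finset.range N,
      (∑ j ∈ Finset.range (n + 1), h (n - j) * v j) * x ^ n ≤ V * P x := by
    have hPx : 0 ≤ P x :=
      Finset.sum_nonneg fun n _ => mul_nonneg (hpos n) (pow_nonneg hx.1 n)
    refine le_trans ?_ (mul_le_mul_of_nonneg_right (hV N) hPx)
    simp_rw [Finset.sum_mul]
    rw [Finset.sum_comm' (t' := Finset.range N) (s' := fun j => Finset.Ico j N)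
      (by simp only [Finset.mem_range, Finset.mem_Ico]; omega)]
    refine Finset.sum_le_sum fun j _ => ?_
    rw [Finset.sum_Ico_eq_sum_range, hP, Finset.mul_sum]
    refine (Finset.sum_le_sum fun i _ => ?_).trans (Finset.sum_le_sum_of_subset_of_nonneg
      (Finset.range_subset_range.2 (by omega : N - j ≤ N + 1)) fun i _ _ =>
        mul_nonneg (hv j) (mul_nonneg (hpos i) (pow_nonneg hx.1 i)))
    rw [Nat.add_sub_cancel_left, mul_comm (h i), mul_assoc]
    exact mul_le_mul_of_nonneg_left (mul_le_mul_of_nonneg_left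
      (pow_le_pow_of_le_one hx.1 hx.2 (Nat.le_add_left i j)) (hpos i)) (hv j)
  have hanti : AntitoneOn (fun x => P x * Real.exp (-(V * x))) (Set.Icc 0 1) := by
    have hd (x : ℝ) := (hderiv x).fun_mul (((hasDerivAt_id' x).const_mul V).fun_neg.exp)
    refine antitoneOn_of_hasDerivWithinAt_nonpos (convex_Icc 0 1)
      (fun x _ => (hd x).continuousAt.continuousWithinAt)
      (fun x _ => (hd x).hasDerivWithinAt) fun x hx => ?_
    have h₁ := hle (interior_subset hx)
    have h₂ := Real.exp_pos (-(V * x))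
    simp only [mul_one]
    nlinarith
  have := hanti (Set.left_mem_Icc.2 zero_le_one) (Set.right_mem_Icc.2 zero_le_one) zero_le_one
  simp only [mul_one, mul_zero, neg_zero, Real.exp_zero, Real.exp_neg] at this
  rw [← div_eq_mul_inv, div_le_iff₀ (Real.exp_pos V)] at this
  have hP0 : P 0 = 1 := by
    simp [hP, Finset.sum_range_succ', h₀]
  rw [hP0, one_mul] at this
  simpa [hP] using this

lemma summable_of_exp_recurrence (hv : ∀ n, 0 ≤ v n) (h₀ : h 0 = 1)
    (hh : ∀ n : ℕ, (n + 1) * h (n + 1) = ∑ j ∈ Finset.range (n + 1), h (n - j) * v j)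
    (hs : Summable v) : Summable h := by
  refine summable_of_sum_range_le (nonneg_of_exp_recurrence hv h₀ hh) (c := Real.exp (∑' n, v n))
    fun n => ?_
  refine le_trans ?_ (sum_le_exp_of_exp_recurrence hv h₀ hh
    (fun n => hs.sum_le_tsum _ fun j _ => hv j) n)
  rw [Finset.sum_range_succ]
  linarith [nonneg_of_exp_recurrence hv h₀ hh n]

/-- A weight that does not change much between `n` and `2 n`. -/
structure IsDoublingWeight (w : ℕ → ℝ) : Prop where
  pos : ∀ n, 0 < w n
  le_four_mul : ∀ {n k : ℕ}, n + 1 ≤ 2 * (k + 1) → w n ≤ 4 * w k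
  tendsto_div : ∀ m, Tendsto (fun n => w (n + m) / w n) atTop (𝓝 1)
  summable_inv : Summable fun n => (w n)⁻¹

namespace IsDoublingWeight

lemma sum_upper_half_le (hw : IsDoublingWeight w) (hv : ∀ n, 0 ≤ v n) (hs : Summable v)
    (hpos : ∀ n, 0 ≤ h n) {A : ℝ} (hA : 0 ≤ A) {n : ℕ} (hhA : ∀ m ≤ n, n < 2 * m → h m * w m ≤ A) :
    ∑ m ∈ Finset.range (n + 1) with ¬ 2 * m ≤ n, h m * (v (n - m) * w n) ≤
      4 * A * ∑' j, v j := by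
  calc ∑ m ∈ Finset.range (n + 1) with ¬ 2 * m ≤ n, h m * (v (n - m) * w n)
      ≤ ∑ m ∈ Finset.range (n + 1) with ¬ 2 * m ≤ n, 4 * A * v (n - m) := by
        refine Finset.sum_le_sum fun m hm => ?_
        rw [Finset.mem_filter, Finset.mem_range] at hm
        have h₁ := hhA m (by omega) (by omega)
        have h₂ := hw.le_four_mul (n := n) (k := m) (by omega)
        have h₃ := mul_le_mul_of_nonneg_left h₂ (mul_nonneg (hpos m) (hv (n - m)))
        have h₄ := mul_le_mul_of_nonneg_right h₁ (hv (n - m))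
        linarith
    _ ≤ ∑ m ∈ Finset.range (n + 1), 4 * A * v (n - m) :=
        Finset.sum_le_sum_of_subset_of_nonneg (Finset.filter_subset _ _)
          fun m _ _ => mul_nonneg (by positivity) (hv _)
    _ = 4 * A * ∑ j ∈ Finset.range (n + 1), v j := by
        rw [← Finset.mul_sum, ← Finset.sum_range_reflect v]
        simp
    _ ≤ 4 * A * ∑' j, v j :=
        mul_le_mul_of_nonneg_left (hs.sum_le_tsum _ fun j _ => hv j) (by positivity)

lemma mul_le_four_mul (hw : IsDoublingWeight w) (hv : ∀ n, 0 ≤ v n) (hB : ∀ n, v n * w n ≤ B)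
    {m n : ℕ} (hm : 2 * m ≤ n) : v (n - m) * w n ≤ 4 * B := by
  have := mul_le_mul_of_nonneg_left (hw.le_four_mul (n := n) (k := n - m) (by omega)) (hv (n - m))
  linarith [hB (n - m)]

lemma sum_lower_half_le (hw : IsDoublingWeight w) (hv : ∀ n, 0 ≤ v n)
    (hB : ∀ n, v n * w n ≤ B) (hpos : ∀ n, 0 ≤ h n) (hs : Summable h) (n : ℕ) :
    ∑ m ∈ Finset.range (n + 1) with 2 * m ≤ n, h m * (v (n - m) * w n) ≤
      4 * B * ∑' j, h j := by
  have hB₀ : 0 ≤ B := (mul_nonneg (hv 0) (hw.pos 0).le).trans (hB 0)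
  calc ∑ m ∈ Finset.range (n + 1) with 2 * m ≤ n, h m * (v (n - m) * w n)
      ≤ ∑ m ∈ Finset.range (n + 1) with 2 * m ≤ n, 4 * B * h m := by
        refine Finset.sum_le_sum fun m hm => ?_
        rw [mul_comm]
        exact mul_le_mul_of_nonneg_right (hw.mul_le_four_mul hv hB (Finset.mem_filter.1 hm).2)
          (hpos m)
    _ ≤ 4 * B * ∑' j, h j := by
        rw [← Finset.mul_sum]
        exact mul_le_mul_of_nonneg_left (hs.sum_le_tsum _ fun j _ => hpos j) (by positivity)

lemma succ_mul_mul_eq_sum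
    (hh : ∀ n : ℕ, (n + 1) * h (n + 1) = ∑ j ∈ Finset.range (n + 1), h (n - j) * v j) (n : ℕ) :
    (n + 1) * h (n + 1) * w n =
      ∑ m ∈ Finset.range (n + 1) with 2 * m ≤ n, h m * (v (n - m) * w n) +
        ∑ m ∈ Finset.range (n + 1) with ¬ 2 * m ≤ n, h m * (v (n - m) * w n) := by
  rw [Finset.sum_filter_add_sum_filter_not, hh, ← Finset.sum_range_reflect, Finset.sum_mul]
  refine Finset.sum_congr rfl fun m hm => ?_
  rw [Finset.mem_range] at hm
  rw [show n - (n + 1 - 1 - m) = m by omega, show n + 1 - 1 - m = n - m by omega, mul_assoc]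

/-- If `h` is the exponential of `v` and `v` is summable and `O(1 / w)`, then `h` is also
`o(1 / w)`. -/
lemma tendsto_mul_zero (hw : IsDoublingWeight w) (hv : ∀ n, 0 ≤ v n)
    (hB : ∀ n, v n * w n ≤ B) (hs : Summable v) (h₀ : h 0 = 1)
    (hh : ∀ n : ℕ, (n + 1) * h (n + 1) = ∑ j ∈ Finset.range (n + 1), h (n - j) * v j) :
    Tendsto (fun n => h n * w n) atTop (𝓝 0) := by
  have hpos := nonneg_of_exp_recurrence hv h₀ hh
  have hsh := summable_of_exp_recurrence hv h₀ hh hs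
  have hB₀ : 0 ≤ B := (mul_nonneg (hv 0) (hw.pos 0).le).trans (hB 0)
  set C₁ := 4 * (4 * B * ∑' j, h j) with hC₁
  set C₂ := 4 * (4 * ∑' j, v j) with hC₂
  have hC₁' : 0 ≤ C₁ := by have : 0 ≤ ∑' j, h j := tsum_nonneg hpos; positivity
  have hC₂' : 0 ≤ C₂ := by have : 0 ≤ ∑' j, v j := tsum_nonneg hv; positivity
  have hstep {A : ℝ} (hA : 0 ≤ A) {n : ℕ} (hhA : ∀ m ≤ n, h m * w m ≤ A) :
      h (n + 1) * w (n + 1) ≤ (C₁ + C₂ * A) / (n + 1) := by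
    have h₁ := succ_mul_mul_eq_sum (w := w) hh n
    have h₂ := hw.sum_upper_half_le hv hs hpos hA (n := n) fun m hm _ => hhA m hm
    have h₃ := hw.sum_lower_half_le hv hB hpos hsh n
    have h₄ := mul_le_mul_of_nonneg_left (hw.le_four_mul (n := n + 1) (k := n) (by omega))
      (mul_nonneg n.cast_add_one_pos.le (hpos (n + 1)))
    rw [le_div_iff₀ (by positivity)]
    linarith
  obtain ⟨N, hN⟩ := exists_nat_ge (2 * C₂)
  obtain ⟨A, hA, hhA⟩ : ∃ A, 0 ≤ A ∧ ∀ m, h m * w m ≤ A := by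
    set M := ∑ m ∈ Finset.range (N + 1), h m * w m with hM
    have hterm (m : ℕ) : 0 ≤ h m * w m := mul_nonneg (hpos m) (hw.pos m).le
    have hM₀ : 0 ≤ M := Finset.sum_nonneg fun m _ => hterm m
    refine ⟨M + 2 * C₁, by positivity, fun m => ?_⟩
    induction m using Nat.strong_induction_on with
    | _ m ih =>
      rcases lt_or_ge N m with hm | hm
      · obtain ⟨n, rfl⟩ := Nat.exists_eq_succ_of_ne_zero (by omega : m ≠ 0)
        refine (hstep (by positivity) fun k hk => ih k (by omega)).trans ?_
        have hn : (N : ℝ) ≤ n := by exact_mod_cast (by omega : N ≤ n)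
        have hn₀ : (0 : ℝ) ≤ n := n.cast_nonneg
        rw [div_le_iff₀ (by positivity)]
        nlinarith [mul_nonneg hn₀ hC₁']
      · have := Finset.single_le_sum (f := fun m => h m * w m) (fun m _ => hterm m)
          (Finset.mem_range.2 (by omega : m < N + 1))
        linarith
  rw [← tendsto_add_atTop_iff_nat 1]
  refine squeeze_zero (fun n => mul_nonneg (hpos _) (hw.pos _).le)
    (fun n => hstep hA fun m _ => hhA m) ?_
  exact tendsto_const_div_natCast_add_one _

lemma summable_of_tendsto (hw : IsDoublingWeight w) (hv : ∀ n, 0 ≤ v n)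
    (hlim : Tendsto (fun n => v n * w n) atTop (𝓝 K)) : Summable v := by
  obtain ⟨B, hB⟩ := hlim.bddAbove_range
  refine Summable.of_nonneg_of_le hv (fun n => ?_) (hw.summable_inv.mul_left B)
  rw [← div_eq_mul_inv, le_div_iff₀ (hw.pos n)]
  exact hB (Set.mem_range_self n)

/-- If `h` is the exponential of `v`, then the asymptotics of `v` is transferred to `h`. -/
lemma tendsto_of_exp_recurrence (hw : IsDoublingWeight w) (hv : ∀ n, 0 ≤ v n) (h₀ : h 0 = 1)
    (hh : ∀ n : ℕ, (n + 1) * h (n + 1) = ∑ j ∈ Finset.range (n + 1), h (n - j) * v j)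
    (hlim : Tendsto (fun n => v n * w n) atTop (𝓝 K)) :
    Tendsto (fun n : ℕ => (n + 1) * h (n + 1) * w n) atTop (𝓝 (∑' m, h m * K)) := by
  obtain ⟨B, hB⟩ := hlim.bddAbove_range
  replace hB (n : ℕ) : v n * w n ≤ B := hB (Set.mem_range_self n)
  have hB₀ : 0 ≤ B := (mul_nonneg (hv 0) (hw.pos 0).le).trans (hB 0)
  have hs := hw.summable_of_tendsto hv hlim
  have hpos := nonneg_of_exp_recurrence hv h₀ hh
  have hsh := summable_of_exp_recurrence hv h₀ hh hs
  have hzero := hw.tendsto_mul_zero hv hB hs h₀ hh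
  have hupper : Tendsto (fun n => ∑ m ∈ Finset.range (n + 1) with ¬ 2 * m ≤ n,
      h m * (v (n - m) * w n)) atTop (𝓝 0) := by
    have hnonneg (n : ℕ) : 0 ≤ ∑ m ∈ Finset.range (n + 1) with ¬ 2 * m ≤ n,
        h m * (v (n - m) * w n) :=
      Finset.sum_nonneg fun m _ => mul_nonneg (hpos m) (mul_nonneg (hv _) (hw.pos n).le)
    rw [Metric.tendsto_atTop]
    intro ε hε
    have hV : 0 ≤ ∑' j, v j := tsum_nonneg hv
    set A := ε / (2 * (4 * ∑' j, v j + 1)) with hA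
    obtain ⟨N, hN⟩ := eventually_atTop.1 (hzero.eventually (ge_mem_nhds (by positivity : 0 < A)))
    refine ⟨2 * N, fun n hn => ?_⟩
    rw [Real.dist_eq, sub_zero, abs_of_nonneg (hnonneg n)]
    refine (hw.sum_upper_half_le hv hs hpos (by positivity : 0 ≤ A)
      fun m _ hm => hN m (by omega)).trans_lt ?_
    rw [hA, mul_div_assoc', div_mul_eq_mul_div, div_lt_iff₀ (by positivity)]
    nlinarith
  have hlower : Tendsto (fun n => ∑ m ∈ Finset.range (n + 1) with 2 * m ≤ n,
      h m * (v (n - m) * w n)) atTop (𝓝 (∑' m, h m * K)) := by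
    have h := tendsto_tsum_of_dominated_convergence (𝓕 := atTop)
      (f := fun n m => if 2 * m ≤ n then h m * (v (n - m) * w n) else 0)
      (g := fun m => h m * K) (hsh.mul_right (4 * B)) (fun m => ?_)
      (Eventually.of_forall fun n m => ?_)
    · refine h.congr fun n => ?_
      rw [tsum_eq_sum (s := Finset.range (n + 1)), Finset.sum_filter]
      intro m hm
      rw [Finset.mem_range] at hm
      exact if_neg (by omega)
    · have hshift : Tendsto (fun n => v (n - m) * w n) atTop (𝓝 K) := by
        rw [← tendsto_add_atTop_iff_nat m]
        have h := hlim.mul (hw.tendsto_div m)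
        rw [mul_one] at h
        refine h.congr fun n => ?_
        have := (hw.pos n).ne'
        rw [Nat.add_sub_cancel]
        field_simp
      refine (hshift.const_mul (h m)).congr' ?_
      filter_upwards [eventually_ge_atTop (2 * m)] with n hn
      rw [if_pos hn]
    · split_ifs with hm
      · rw [Real.norm_of_nonneg (mul_nonneg (hpos m) (mul_nonneg (hv _) (hw.pos n).le))]
        exact mul_le_mul_of_nonneg_left (hw.mul_le_four_mul hv hB hm) (hpos m)
      · rw [norm_zero]
        exact mul_nonneg (hpos m) (by positivity)
  have h := hlower.add hupper
  rw [add_zero] at h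
  exact h.congr fun n => (succ_mul_mul_eq_sum hh n).symm

end IsDoublingWeight

end ExpRecurrence

lemma isDoublingWeight_threeHalves : IsDoublingWeight fun n : ℕ => ((n : ℝ) + 1) * √(n + 1) where
  pos n := by positivity
  le_four_mul {n k} h := by
    have h' : (n : ℝ) + 1 ≤ 2 * (k + 1) := by exact_mod_cast h
    have hs : √((n : ℝ) + 1) ≤ 2 * √(k + 1) := by
      rw [Real.sqrt_le_left (by positivity), mul_pow, Real.sq_sqrt (by positivity)]
      linarith
    calc ((n : ℝ) + 1) * √(n + 1) ≤ (2 * (k + 1)) * (2 * √(k + 1)) := by gcongr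
      _ = _ := by ring
  tendsto_div m := by
    have h : Tendsto (fun n : ℕ => ((n : ℝ) + 1 + m) / (n + 1)) atTop (𝓝 1) := by
      have h := (tendsto_const_div_natCast_add_one (m : ℝ)).const_add 1
      rw [add_zero] at h
      refine h.congr fun n => ?_
      have : (n : ℝ) + 1 ≠ 0 := n.cast_add_one_ne_zero
      field_simp
    have h' := h.mul h.sqrt
    rw [Real.sqrt_one, mul_one] at h'
    refine h'.congr fun n => ?_
    rw [Real.sqrt_div (by positivity), div_mul_div_comm]
    push_cast
    ring_nf
  summable_inv := by
    have h := (summable_nat_add_iff 1).2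
      (Real.summable_nat_rpow_inv.2 (by norm_num : (1 : ℝ) < 3 / 2))
    refine h.congr fun n => ?_
    push_cast
    rw [show (3 / 2 : ℝ) = 1 + 1 / 2 by norm_num, Real.rpow_add (by positivity), Real.rpow_one,
      Real.sqrt_eq_rpow]

open Finset in
lemma succ_mul_div_factorial_of_binomial_recurrence {t t₁ q : ℕ → ℕ} {n : ℕ}
    (h : t (n + 1) = ∑ j ∈ range (n + 1), n.choose j * (t₁ (n - j) * q j)) :
    ((n : ℝ) + 1) * (t (n + 1) / (n + 1).factorial) =
      ∑ j ∈ range (n + 1), (t₁ (n - j) / (n - j).factorial : ℝ) * (q j / j.factorial) := by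
  have hn : ((n : ℝ) + 1) ≠ 0 := n.cast_add_one_ne_zero
  have hfac (m : ℕ) : (m.factorial : ℝ) ≠ 0 := Nat.cast_ne_zero.2 m.factorial_ne_zero
  rw [h, Nat.factorial_succ]
  push_cast
  rw [mul_div_assoc', mul_div_mul_left _ _ hn, sum_div]
  refine sum_congr rfl fun j hj => ?_
  rw [Nat.cast_choose ℝ (Nat.lt_succ_iff.1 (mem_range.1 hj))]
  have := hfac n
  have := hfac j
  have := hfac (n - j)
  field_simp

/-- The asymptotics of a class of forests from that of its rooted trees. -/
lemma exists_tendsto_of_forest_recurrence {t f : ℕ → ℝ} {ρ K : ℝ} (ht : ∀ n, 0 ≤ t n)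
    (hf₀ : f 0 = 1)
    (hf : ∀ n : ℕ, (n + 1) * f (n + 1) = ∑ j ∈ Finset.range (n + 1), f (n - j) * t j)
    (hρ : 0 < ρ) (hK : 0 < K)
    (hlim : Tendsto (fun n : ℕ => t n * ρ ^ (n + 1) * ((n + 1) * √(n + 1))) atTop (𝓝 K)) :
    ∃ L > 0, Tendsto (fun n : ℕ => (n + 1) * (f (n + 1) * ρ ^ (n + 1)) * ((n + 1) * √(n + 1)))
      atTop (𝓝 L) := by
  have hv (n : ℕ) : 0 ≤ t n * ρ ^ (n + 1) := mul_nonneg (ht n) (by positivity)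
  have h₀ : f 0 * ρ ^ 0 = 1 := by simp [hf₀]
  have hh (n : ℕ) : (n + 1) * (f (n + 1) * ρ ^ (n + 1)) =
      ∑ j ∈ Finset.range (n + 1), f (n - j) * ρ ^ (n - j) * (t j * ρ ^ (j + 1)) := by
    rw [← mul_assoc, hf, Finset.sum_mul]
    refine Finset.sum_congr rfl fun j hj => ?_
    have hj : n + 1 = n - j + (j + 1) := by have := Finset.mem_range.1 hj; omega
    rw [hj, pow_add]
    ring
  have h := isDoublingWeight_threeHalves.tendsto_of_exp_recurrence
    (h := fun n => f n * ρ ^ n) hv h₀ hh hlim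
  refine ⟨_, ?_, h⟩
  have hpos := nonneg_of_exp_recurrence (h := fun n => f n * ρ ^ n) hv h₀ hh
  have hs := summable_of_exp_recurrence (h := fun n => f n * ρ ^ n) hv h₀ hh
    (isDoublingWeight_threeHalves.summable_of_tendsto hv hlim)
  refine (hs.mul_right K).tsum_pos (fun n => mul_nonneg (hpos n) hK.le) 0 ?_
  rw [h₀, one_mul]
  exact hK

namespace SimpleGraph

/-- The exponentially normalised number of rooted trees. -/
noncomputable def treeCoeff (P : RootedPred) (n : ℕ) : ℝ :=
  treeCount P (Fin (n + 1)) 0 / n.factorial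

/-- The exponentially normalised number of forests. -/
noncomputable def forestCoeff (P : ∀ V : Type, SimpleGraph V → Set V → Prop) (n : ℕ) : ℝ :=
  forestCount P (Fin n) / n.factorial

lemma succ_mul_treeCoeff {P P₁ Q : RootedPred} (h₁ : P₁.Invariant) (hQ : Q.Invariant)
    (h : P.Splits P₁ Q) (n : ℕ) :
    (n + 1) * treeCoeff P (n + 1) =
      ∑ j ∈ Finset.range (n + 1), treeCoeff P₁ (n - j) * ((j + 1) * treeCoeff Q j) := by
  have := succ_mul_div_factorial_of_binomial_recurrence
    (t := fun n => treeCount P (Fin (n + 1)) 0) (t₁ := fun n => treeCount P₁ (Fin (n + 1)) 0)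
    (q := fun j => (j + 1) * treeCount Q (Fin (j + 1)) 0) (n := n) (by
      rw [treeCount_succ h₁ hQ h]
      exact Finset.sum_congr rfl fun j _ => by ring)
  refine this.trans (Finset.sum_congr rfl fun j _ => ?_)
  rw [treeCoeff, treeCoeff]
  push_cast
  ring

lemma succ_mul_forestCoeff {P : ∀ V : Type, SimpleGraph V → Set V → Prop}
    (hP : RootedPred.Invariant fun V _ => P V)
    (hemp : ∀ (V : Type) [IsEmpty V] (G : SimpleGraph V) (J : Set V), P V G J)
    (h : ∀ ⦃V : Type⦄ (G : SimpleGraph V) (U J : Set V), G.CrossBy U (fun _ _ => False) →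
      (P V G J ↔ P ↥Uᶜ (G.induce Uᶜ) (Subtype.val ⁻¹' J) ∧ P U (G.induce U) (Subtype.val ⁻¹' J)))
    (n : ℕ) :
    (n + 1) * forestCoeff P (n + 1) =
      ∑ j ∈ Finset.range (n + 1), forestCoeff P (n - j) * treeCoeff (fun V _ => P V) j := by
  have := succ_mul_div_factorial_of_binomial_recurrence (t := fun n => forestCount P (Fin n))
    (t₁ := fun n => forestCount P (Fin n))
    (q := fun j => treeCount (fun V _ => P V) (Fin (j + 1)) 0) (n := n)
    (forestCount_succ hP hemp h n)
  exact this

lemma treeCoeff_nonneg (P : RootedPred) (n : ℕ) : 0 ≤ treeCoeff P n := by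
  unfold treeCoeff
  positivity

lemma forestCoeff_zero (P : ∀ V : Type, SimpleGraph V → Set V → Prop)
    (hemp : ∀ (V : Type) [IsEmpty V] (G : SimpleGraph V) (J : Set V), P V G J) :
    forestCoeff P 0 = 1 := by
  simp [forestCoeff, forestCount_zero P hemp]

lemma treeCoeff_rootDom (n : ℕ) :
    treeCoeff rootDom n = treeCoeff rootNotMem n - treeCoeff rootUndom n := by
  rw [treeCoeff, treeCoeff, treeCoeff, treeCount_rootNotMem]
  push_cast
  ring

lemma treeCoeff_indepDom (n : ℕ) : treeCoeff (fun V _ => indepDom V) n =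
    treeCoeff rootMem n + (treeCoeff rootNotMem n - treeCoeff rootUndom n) := by
  rw [← treeCoeff_rootDom, treeCoeff, treeCoeff, treeCoeff, treeCount_indepDom]
  push_cast
  ring

/-- The asymptotics of the number of forests. -/
lemma exists_tendsto_forestCoeff_noSet : ∃ L > 0, Tendsto (fun n : ℕ =>
    (n + 1) * (forestCoeff noSet (n + 1) * Real.exp (-1) ^ (n + 1)) * ((n + 1) * √(n + 1)))
      atTop (𝓝 L) := by
  obtain ⟨K, hK, hlim⟩ := exists_tendsto_of_tree_recurrence
    (o := treeCoeff fun V _ => noSet V) (by simp [treeCoeff, treeCount_noSet_one])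
    (succ_mul_treeCoeff noSet_invariant noSet_invariant noSet_splits)
  exact exists_tendsto_of_forest_recurrence (treeCoeff_nonneg _)
    (forestCoeff_zero _ fun V _ => noSet_of_isEmpty V)
    (succ_mul_forestCoeff noSet_invariant (fun V _ => noSet_of_isEmpty V)
      fun V G U J _ => noSet_iff U G J) (Real.exp_pos _) hK hlim

/-- The asymptotics of the number of forests with a maximal independent set. -/
lemma exists_tendsto_forestCoeff_indepDom : ∃ ρ : ℝ, 0 < ρ ∧ ρ < Real.exp (-1) ∧
    ∃ L > 0, Tendsto (fun n : ℕ =>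
      (n + 1) * (forestCoeff indepDom (n + 1) * ρ ^ (n + 1)) * ((n + 1) * √(n + 1)))
      atTop (𝓝 L) := by
  obtain ⟨ρ, hρ₀, hρ, K, hK, hlim⟩ := exists_tendsto_of_mis_recurrence
    (a := treeCoeff rootMem) (e := treeCoeff rootNotMem) (d := treeCoeff rootUndom)
    (by simp [treeCoeff, treeCount_rootMem_one]) (by simp [treeCoeff, treeCount_rootNotMem_one])
    (by simp [treeCoeff, treeCount_rootUndom_one])
    (succ_mul_treeCoeff rootMem_invariant rootNotMem_invariant rootMem_splits)
    (fun n => by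
      simp_rw [← treeCoeff_rootDom]
      exact succ_mul_treeCoeff rootUndom_invariant rootDom_invariant rootUndom_splits n)
    (fun n => by
      simp_rw [← treeCoeff_indepDom]
      exact succ_mul_treeCoeff rootNotMem_invariant indepDom_invariant rootNotMem_splits n)
  simp_rw [← treeCoeff_indepDom] at hlim
  exact ⟨ρ, hρ₀, hρ, exists_tendsto_of_forest_recurrence (treeCoeff_nonneg _)
    (forestCoeff_zero _ fun V _ => indepDom_of_isEmpty V)
    (succ_mul_forestCoeff indepDom_invariant (fun V _ => indepDom_of_isEmpty V)
      fun V G U J h => h.indepDom_iff) hρ₀ hK hlim⟩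

end SimpleGraph

theorem stmt_7 :
    ∃ C α : ℝ, 0 < C ∧ 1 < α ∧
      Tendsto (fun n : ℕ => ((iN n : ℝ) / (fN n : ℝ)) / α ^ n) atTop (nhds C) := by
  obtain ⟨ρ, hρ₀, hρ, L, hL, hlim⟩ := SimpleGraph.exists_tendsto_forestCoeff_indepDom
  obtain ⟨L', hL', hlim'⟩ := SimpleGraph.exists_tendsto_forestCoeff_noSet
  refine ⟨L / L', Real.exp (-1) / ρ, by positivity, (one_lt_div hρ₀).2 hρ, ?_⟩
  rw [← tendsto_add_atTop_iff_nat 1]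
  refine (hlim.div hlim' hL'.ne').congr fun n => ?_
  have hn : (n : ℝ) + 1 ≠ 0 := n.cast_add_one_ne_zero
  have hs : √((n : ℝ) + 1) ≠ 0 := by positivity
  have hfac : ((n + 1).factorial : ℝ) ≠ 0 := Nat.cast_ne_zero.2 (n + 1).factorial_ne_zero
  rw [Pi.div_apply, SimpleGraph.forestCoeff, SimpleGraph.forestCoeff,
    ← SimpleGraph.iN_eq_forestCount, ← SimpleGraph.fN_eq_forestCount, div_pow,
    mul_div_mul_right _ _ (mul_ne_zero hn hs), mul_div_mul_left _ _ hn, mul_div_mul_comm,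
    div_div_div_cancel_right₀ hfac, div_div_eq_mul_div, mul_div_assoc]
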